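/- arXiv:1307.0046 — 2 statements merged into one kernel-verified Lean document; each statement's English description precedes it below -/
import Mathlib

section
/- Let μ, ν ∈ ℝ and let f : [0,∞) → ℝ be continuously differentiable with f and f' bounded and f(x) → 0 as x → ∞. If u is a solution of the Stroock–Williams problem with parameters μ, ν and initial data f, then for every t > 0 and x ≥ 0: u(t,x) = ∫₀^∞ ∫_{−∞}^{s} [ f(max(x,s) − b) − f'(max(x,s) − b) · ∫₀^{max(x,s) − x} e^{−2(ν−μ)r} dr ] g(t;b,s) db ds. -/
open MeasureTheory Set Filter

/-- Standard normal density. -/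
noncomputable def phi (x : ℝ) : ℝ := (1 / Real.sqrt (2 * Real.pi)) * Real.exp (-x ^ 2 / 2)

/-- Standard normal tail function. -/
noncomputable def Psi (x : ℝ) : ℝ := ∫ y in Set.Ioi x, phi y

/-- The kernel `G(t;x,y)` with drift parameter `μ`. -/
noncomputable def Gker (μ t x y : ℝ) : ℝ :=
  (1 / Real.sqrt t) *
      (Real.exp (2 * μ * y) * phi ((x + y + μ * t) / Real.sqrt t) +
        phi ((x - y + μ * t) / Real.sqrt t)) -
    2 * μ * Real.exp (2 * μ * y) * Psi ((x + y + μ * t) / Real.sqrt t)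

/-- The kernel `H(t;x,y)` with parameters `μ, ν`. -/
noncomputable def Hker (μ ν t x y : ℝ) : ℝ :=
  if ν = μ then
    2 * Real.exp (2 * μ * y) *
      ((1 + μ * (x + y + μ * t)) * Psi ((x + y + μ * t) / Real.sqrt t) -
        μ * Real.sqrt t * phi ((x + y + μ * t) / Real.sqrt t))
  else
    Real.exp (2 * μ * y) / (ν - μ) *
      ((2 * ν - μ) * Real.exp (2 * (ν - μ) * (x + y + ν * t)) *
          Psi ((x + y + (2 * ν - μ) * t) / Real.sqrt t) -
        μ * Psi ((x + y + μ * t) / Real.sqrt t))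

/-- The density `g(t;b,s)` of `(B_t^{-μ}, S_t^{-μ})`, vanishing off `{b ≤ s, 0 ≤ s}`. -/
noncomputable def gker (μ t b s : ℝ) : ℝ :=
  if b ≤ s ∧ 0 ≤ s then
    Real.sqrt (2 / Real.pi) * t ^ (-(3 : ℝ) / 2) * (2 * s - b) *
      Real.exp (-(2 * s - b) ^ 2 / (2 * t) - μ * (b + μ * t / 2))
  else 0

/-- Spatial derivative (one-sided at `x = 0`). -/
noncomputable def ux (u : ℝ → ℝ → ℝ) (t x : ℝ) : ℝ :=
  derivWithin (fun z => u t z) (Set.Ici 0) x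

/-- Second spatial derivative (one-sided at `x = 0`). -/
noncomputable def uxx (u : ℝ → ℝ → ℝ) (t x : ℝ) : ℝ :=
  derivWithin (fun z => ux u t z) (Set.Ici 0) x

/-- Time derivative. -/
noncomputable def ut (u : ℝ → ℝ → ℝ) (t x : ℝ) : ℝ :=
  deriv (fun s => u s x) t

/-- `u` is a solution of the Stroock–Williams problem with parameters `μ, ν`
and initial data `f`. -/
def IsSWSolution (μ ν : ℝ) (f : ℝ → ℝ) (u : ℝ → ℝ → ℝ) : Prop :=
  ContDiffOn ℝ (⊤ : ℕ∞) (fun p : ℝ × ℝ => u p.1 p.2) (Set.Ioi 0 ×ˢ Set.Ici 0) ∧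
  (∀ T > (0 : ℝ),
    ContinuousOn (fun p : ℝ × ℝ => u p.1 p.2) (Set.Icc 0 T ×ˢ Set.Ici 0) ∧
    ContinuousOn (fun p : ℝ × ℝ => ux u p.1 p.2) (Set.Icc 0 T ×ˢ Set.Ici 0) ∧
    ∃ C : ℝ, ∀ p ∈ Set.Icc (0 : ℝ) T ×ˢ Set.Ici (0 : ℝ),
      |u p.1 p.2| ≤ C ∧ |ux u p.1 p.2| ≤ C) ∧
  (∀ t > (0 : ℝ), Filter.Tendsto (fun x => u t x) Filter.atTop (nhds 0)) ∧
  (∀ t > (0 : ℝ), ∀ x ≥ (0 : ℝ), ut u t x = μ * ux u t x + (1 / 2) * uxx u t x) ∧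
  (∀ x ≥ (0 : ℝ), u 0 x = f x) ∧
  (∀ t > (0 : ℝ), ut u t 0 = ν * ux u t 0)

/-- `f` is admissible initial data: `C¹` on `[0,∞)` with `f` and `f'` bounded
and `f(x) → 0` as `x → ∞`. -/
def IsInitialData (f : ℝ → ℝ) : Prop :=
  ContDiffOn ℝ 1 f (Set.Ici 0) ∧
  (∃ C : ℝ, ∀ x ∈ Set.Ici (0 : ℝ), |f x| ≤ C ∧ |derivWithin f (Set.Ici 0) x| ≤ C) ∧
  Filter.Tendsto f Filter.atTop (nhds 0)

/-! ### The standard normal density and its tail -/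

lemma phi_nonneg (x : ℝ) : 0 ≤ phi x := by
  unfold phi; positivity

lemma phi_neg (x : ℝ) : phi (-x) = phi x := by
  unfold phi; simp

lemma phi_eq_gaussianPDFReal : phi = ProbabilityTheory.gaussianPDFReal 0 1 := by
  ext x
  simp [phi, ProbabilityTheory.gaussianPDFReal]

lemma continuous_phi : Continuous phi := by
  unfold phi; fun_prop

lemma integrable_phi : Integrable phi := by
  rw [phi_eq_gaussianPDFReal]
  exact ProbabilityTheory.integrable_gaussianPDFReal 0 1

lemma integral_phi : ∫ x, phi x = 1 := by
  rw [phi_eq_gaussianPDFReal]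
  exact ProbabilityTheory.integral_gaussianPDFReal_eq_one 0 one_ne_zero

lemma hasDerivAt_phi (x : ℝ) : HasDerivAt phi (-x * phi x) x := by
  have h : HasDerivAt (fun y : ℝ => -y ^ 2 / 2) (-x) x := by
    have := ((hasDerivAt_id x).pow 2).neg.div_const 2
    convert! this using 1
    simp
    ring
  have := h.exp.const_mul (1 / Real.sqrt (2 * Real.pi))
  convert! this using 1
  unfold phi; ring

lemma phi_le_exp (θ x : ℝ) : phi x ≤ Real.exp (-θ * x + θ ^ 2 / 2) := by
  have h1 : 1 / Real.sqrt (2 * Real.pi) ≤ 1 := by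
    rw [div_le_one (by positivity)]
    exact Real.one_le_sqrt.2 (by nlinarith [Real.pi_gt_three])
  calc phi x ≤ 1 * Real.exp (-x ^ 2 / 2) := by
        unfold phi; gcongr
    _ ≤ Real.exp (-θ * x + θ ^ 2 / 2) := by
        rw [one_mul]
        apply Real.exp_le_exp.2
        nlinarith [sq_nonneg (x - θ)]

lemma exp_mul_phi (θ x : ℝ) : Real.exp (θ * x) * phi x = Real.exp (θ ^ 2 / 2) * phi (x - θ) := by
  unfold phi
  rw [mul_left_comm, ← Real.exp_add, mul_left_comm (Real.exp _), ← Real.exp_add]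
  congr 2; ring

lemma integrable_exp_mul_phi (θ : ℝ) : Integrable fun x => Real.exp (θ * x) * phi x := by
  simp_rw [exp_mul_phi]
  exact (integrable_phi.comp_sub_right θ).const_mul _

lemma integrable_exp_abs_mul_phi (θ : ℝ) :
    Integrable fun x => Real.exp (θ * |x|) * phi x := by
  refine ((integrable_exp_mul_phi θ).add (integrable_exp_mul_phi (-θ))).mono'
    (by have := continuous_phi; fun_prop) (Eventually.of_forall fun x => ?_)
  rw [Real.norm_of_nonneg (mul_nonneg (Real.exp_nonneg _) (phi_nonneg x)), Pi.add_apply,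
    ← add_mul]
  gcongr
  · exact phi_nonneg x
  rcases abs_cases x with ⟨h, _⟩ | ⟨h, _⟩ <;> rw [h]
  · linarith [Real.exp_nonneg (-θ * x)]
  · rw [show θ * -x = -θ * x by ring]
    linarith [Real.exp_nonneg (θ * x)]

lemma Psi_nonneg (x : ℝ) : 0 ≤ Psi x :=
  integral_nonneg fun y => phi_nonneg y

lemma Psi_eq (x : ℝ) : Psi x = Psi 0 - ∫ y in (0 : ℝ)..x, phi y := by
  have := intervalIntegral.integral_Ioi_sub_Ioi' (μ := volume) (f := phi) (a := 0) (b := x)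
    integrable_phi.integrableOn integrable_phi.integrableOn
  unfold Psi
  linarith

lemma hasDerivAt_Psi (x : ℝ) : HasDerivAt Psi (-phi x) x := by
  have h := (intervalIntegral.integral_hasDerivAt_right (a := 0) (b := x)
    integrable_phi.intervalIntegrable
    continuous_phi.stronglyMeasurable.stronglyMeasurableAtFilter
    continuous_phi.continuousAt).const_sub (Psi 0)
  have he : Psi = fun x => Psi 0 - ∫ y in (0 : ℝ)..x, phi y := funext Psi_eq
  rw [he]
  exact h

lemma continuous_Psi : Continuous Psi :=
  continuous_iff_continuousAt.2 fun x => (hasDerivAt_Psi x).continuousAt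

lemma Psi_le_exp {θ : ℝ} (hθ : 0 ≤ θ) (x : ℝ) : Psi x ≤ Real.exp (-θ * x + θ ^ 2 / 2) := by
  have h1 : Psi x ≤ ∫ y in Ioi x, Real.exp (-θ * x) * (Real.exp (θ * y) * phi y) := by
    refine setIntegral_mono_on integrable_phi.integrableOn
      ((integrable_exp_mul_phi θ).const_mul _).integrableOn measurableSet_Ioi fun y hy => ?_
    rw [← mul_assoc, ← Real.exp_add]
    refine le_mul_of_one_le_left (phi_nonneg y) (Real.one_le_exp ?_)
    have : 0 ≤ θ * (y - x) := mul_nonneg hθ (sub_nonneg.2 (le_of_lt hy))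
    linarith
  have h2 : ∫ y in Ioi x, Real.exp (-θ * x) * (Real.exp (θ * y) * phi y) ≤
      ∫ y, Real.exp (-θ * x) * (Real.exp (θ * y) * phi y) :=
    setIntegral_le_integral ((integrable_exp_mul_phi θ).const_mul _)
      (Eventually.of_forall fun y => mul_nonneg (Real.exp_nonneg _)
        (mul_nonneg (Real.exp_nonneg _) (phi_nonneg y)))
  have h3 : ∫ y, Real.exp (-θ * x) * (Real.exp (θ * y) * phi y) =
      Real.exp (-θ * x + θ ^ 2 / 2) := by
    simp_rw [exp_mul_phi]
    rw [integral_const_mul, integral_const_mul, integral_sub_right_eq_self phi θ, integral_phi,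
      Real.exp_add, mul_one]
  linarith

lemma tendsto_Psi_atTop : Tendsto Psi atTop (nhds 0) := by
  refine squeeze_zero Psi_nonneg (fun x => Psi_le_exp zero_le_one x) ?_
  refine Real.tendsto_exp_atBot.comp ?_
  exact tendsto_atBot_add_const_right _ _
    ((tendsto_neg_atTop_atBot (G := ℝ)).congr fun x => by ring)

/-! ### The heat kernel on the line and its exponentially weighted tail -/

/-- The heat kernel of `∂ₜ = ½ ∂ₐₐ` on the line. -/
noncomputable def heatKer (τ a : ℝ) : ℝ := phi (a / Real.sqrt τ) / Real.sqrt τ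

/-- The weighted tail `∫₀^∞ exp (-κ z) heatKer τ (a + z) dz`, in closed form. -/
noncomputable def tailKer (κ τ a : ℝ) : ℝ :=
  Real.exp (κ * a + κ ^ 2 * τ / 2) * Psi ((a + κ * τ) / Real.sqrt τ)

lemma heatKer_nonneg (τ a : ℝ) : 0 ≤ heatKer τ a :=
  div_nonneg (phi_nonneg _) (Real.sqrt_nonneg _)

lemma heatKer_neg (τ a : ℝ) : heatKer τ (-a) = heatKer τ a := by
  unfold heatKer; rw [neg_div, phi_neg]

lemma tailKer_nonneg (κ τ a : ℝ) : 0 ≤ tailKer κ τ a :=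
  mul_nonneg (Real.exp_nonneg _) (Psi_nonneg _)

lemma hasDerivAt_heatKer {τ : ℝ} (hτ : 0 < τ) (a : ℝ) :
    HasDerivAt (heatKer τ) (-(a / τ) * heatKer τ a) a := by
  have hs : 0 < Real.sqrt τ := Real.sqrt_pos.2 hτ
  have h := ((hasDerivAt_phi (a / Real.sqrt τ)).comp a
    ((hasDerivAt_id a).div_const (Real.sqrt τ))).div_const (Real.sqrt τ)
  convert! h using 1
  unfold heatKer
  nth_rewrite 1 [← Real.mul_self_sqrt hτ.le]
  field_simp

lemma hasDerivAt_sqrt_div (a b : ℝ) {τ : ℝ} (hτ : 0 < τ) :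
    HasDerivAt (fun r => (a + b * r) / Real.sqrt r)
      ((b / 2 - a / (2 * τ)) / Real.sqrt τ) τ := by
  have hs : 0 < Real.sqrt τ := Real.sqrt_pos.2 hτ
  have h := (((hasDerivAt_id τ).const_mul b).const_add a).div (Real.hasDerivAt_sqrt hτ.ne') hs.ne'
  convert! h using 1
  simp only [id]
  have h2 : τ = Real.sqrt τ * Real.sqrt τ := (Real.mul_self_sqrt hτ.le).symm
  set r := Real.sqrt τ
  rw [h2]
  field_simp
  ring

lemma hasDerivAt_heatKer_time {τ : ℝ} (hτ : 0 < τ) (a : ℝ) :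
    HasDerivAt (fun r => heatKer r a) ((a ^ 2 / τ ^ 2 - 1 / τ) * heatKer τ a / 2) τ := by
  have hs : 0 < Real.sqrt τ := Real.sqrt_pos.2 hτ
  have h1 := hasDerivAt_sqrt_div a 0 hτ
  simp only [zero_mul, add_zero] at h1
  have h := ((hasDerivAt_phi (a / Real.sqrt τ)).comp τ h1).div (Real.hasDerivAt_sqrt hτ.ne') hs.ne'
  convert! h using 1
  unfold heatKer
  have h2 : τ = Real.sqrt τ * Real.sqrt τ := (Real.mul_self_sqrt hτ.le).symm
  simp only [Function.comp]
  set r := Real.sqrt τ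
  rw [h2]
  field_simp
  ring

lemma exp_mul_phi_eq_heatKer (κ : ℝ) {τ : ℝ} (hτ : 0 < τ) (a : ℝ) :
    Real.exp (κ * a + κ ^ 2 * τ / 2) * phi ((a + κ * τ) / Real.sqrt τ) / Real.sqrt τ =
      heatKer τ a := by
  unfold heatKer phi
  rw [mul_left_comm, ← Real.exp_add]
  congr 3
  rw [div_pow, div_pow, Real.sq_sqrt hτ.le]
  field_simp
  ring

lemma hasDerivAt_tailKer (κ : ℝ) {τ : ℝ} (hτ : 0 < τ) (a : ℝ) :
    HasDerivAt (tailKer κ τ) (κ * tailKer κ τ a - heatKer τ a) a := by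
  have h1 : HasDerivAt (fun a => κ * a + κ ^ 2 * τ / 2) κ a := by
    simpa using ((hasDerivAt_id a).const_mul κ).add_const (κ ^ 2 * τ / 2)
  have h := h1.exp.mul ((hasDerivAt_Psi ((a + κ * τ) / Real.sqrt τ)).comp a
    (((hasDerivAt_id a).add_const (κ * τ)).div_const (Real.sqrt τ)))
  convert! h using 1
  rw [← exp_mul_phi_eq_heatKer κ hτ]
  simp only [tailKer, Function.comp, id]
  ring

lemma hasDerivAt_tailKer_time (κ : ℝ) {τ : ℝ} (hτ : 0 < τ) (a : ℝ) :
    HasDerivAt (fun r => tailKer κ r a)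
      ((κ * (κ * tailKer κ τ a - heatKer τ a) - -(a / τ) * heatKer τ a) / 2) τ := by
  have h1 : HasDerivAt (fun r => κ * a + κ ^ 2 * r / 2) (κ ^ 2 / 2) τ := by
    simpa using (((hasDerivAt_id τ).const_mul (κ ^ 2)).div_const 2).const_add (κ * a)
  have h := h1.exp.mul ((hasDerivAt_Psi ((a + κ * τ) / Real.sqrt τ)).comp τ
    (hasDerivAt_sqrt_div a κ hτ))
  convert! h using 1
  rw [← exp_mul_phi_eq_heatKer κ hτ]
  simp only [tailKer, Function.comp]
  field_simp
  ring

lemma heatKer_le {τ : ℝ} (hτ : 0 < τ) (B a : ℝ) :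
    heatKer τ a ≤ Real.exp (-B * a + B ^ 2 * τ / 2) / Real.sqrt τ := by
  have hs : 0 < Real.sqrt τ := Real.sqrt_pos.2 hτ
  unfold heatKer
  gcongr
  refine (phi_le_exp (B * Real.sqrt τ) _).trans (le_of_eq ?_)
  congr 1
  rw [mul_pow, Real.sq_sqrt hτ.le]
  field_simp

lemma tailKer_le {κ τ : ℝ} (hτ : 0 < τ) {B : ℝ} (hB : -κ ≤ B) (a : ℝ) :
    tailKer κ τ a ≤ Real.exp (-B * a + B ^ 2 * τ / 2) := by
  have hs : 0 < Real.sqrt τ := Real.sqrt_pos.2 hτ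
  unfold tailKer
  have h := Psi_le_exp (θ := (B + κ) * Real.sqrt τ) (mul_nonneg (by linarith) hs.le)
    ((a + κ * τ) / Real.sqrt τ)
  refine (mul_le_mul_of_nonneg_left h (Real.exp_nonneg _)).trans (le_of_eq ?_)
  rw [← Real.exp_add]
  congr 1
  rw [mul_pow, Real.sq_sqrt hτ.le]
  field_simp
  ring

lemma continuousOn_heatKer :
    ContinuousOn (fun p : ℝ × ℝ => heatKer p.1 p.2) (Ioi 0 ×ˢ univ) := by
  unfold heatKer
  have h : ∀ p ∈ (Ioi (0 : ℝ) ×ˢ (univ : Set ℝ)), Real.sqrt p.1 ≠ 0 :=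
    fun p hp => (Real.sqrt_pos.2 hp.1).ne'
  have h1 : ContinuousOn (fun p : ℝ × ℝ => Real.sqrt p.1) (Ioi 0 ×ˢ univ) :=
    (Real.continuous_sqrt.comp continuous_fst).continuousOn
  exact (continuous_phi.comp_continuousOn (continuousOn_snd.div h1 h)).div h1 h

lemma continuousOn_tailKer (κ : ℝ) :
    ContinuousOn (fun p : ℝ × ℝ => tailKer κ p.1 p.2) (Ioi 0 ×ˢ univ) := by
  unfold tailKer
  have h : ∀ p ∈ (Ioi (0 : ℝ) ×ˢ (univ : Set ℝ)), Real.sqrt p.1 ≠ 0 :=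
    fun p hp => (Real.sqrt_pos.2 hp.1).ne'
  have h1 : ContinuousOn (fun p : ℝ × ℝ => Real.sqrt p.1) (Ioi 0 ×ˢ univ) :=
    (Real.continuous_sqrt.comp continuous_fst).continuousOn
  refine ContinuousOn.mul (by fun_prop)
    (continuous_Psi.comp_continuousOn (ContinuousOn.div ?_ h1 h))
  fun_prop

/-! ### The heat kernel on the half-line with a Robin boundary condition -/

/-- The kernel on the half-line with `∂_y q = κ q` at `y = 0`. -/
noncomputable def robinKer (κ x τ y : ℝ) : ℝ :=
  heatKer τ (y - x) + heatKer τ (y + x) - 2 * κ * tailKer κ τ (y + x)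

/-- The `y`-derivative of `robinKer`. -/
noncomputable def robinKer₁ (κ x τ y : ℝ) : ℝ :=
  -((y - x) / τ) * heatKer τ (y - x) + -((y + x) / τ) * heatKer τ (y + x) -
    2 * κ * (κ * tailKer κ τ (y + x) - heatKer τ (y + x))

/-- The second `y`-derivative of `robinKer`. -/
noncomputable def robinKer₂ (κ x τ y : ℝ) : ℝ :=
  ((y - x) ^ 2 / τ ^ 2 - 1 / τ) * heatKer τ (y - x) +
      ((y + x) ^ 2 / τ ^ 2 - 1 / τ) * heatKer τ (y + x) -
    2 * κ * (κ * (κ * tailKer κ τ (y + x) - heatKer τ (y + x)) -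
      -((y + x) / τ) * heatKer τ (y + x))

lemma hasDerivAt_robinKer (κ x : ℝ) {τ : ℝ} (hτ : 0 < τ) (y : ℝ) :
    HasDerivAt (robinKer κ x τ) (robinKer₁ κ x τ y) y :=
  (((hasDerivAt_heatKer hτ (y - x)).comp_sub_const y x).add
    ((hasDerivAt_heatKer hτ (y + x)).comp_add_const y x)).sub
    (((hasDerivAt_tailKer κ hτ (y + x)).comp_add_const y x).const_mul (2 * κ))

lemma hasDerivAt_neg_div_mul_heatKer {τ : ℝ} (hτ : 0 < τ) (a : ℝ) :
    HasDerivAt (fun a => -(a / τ) * heatKer τ a) ((a ^ 2 / τ ^ 2 - 1 / τ) * heatKer τ a) a := by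
  have h := ((hasDerivAt_id a).div_const τ).neg.mul (hasDerivAt_heatKer hτ a)
  convert! h using 1
  simp
  ring

lemma hasDerivAt_robinKer₁ (κ x : ℝ) {τ : ℝ} (hτ : 0 < τ) (y : ℝ) :
    HasDerivAt (robinKer₁ κ x τ) (robinKer₂ κ x τ y) y :=
  (((hasDerivAt_neg_div_mul_heatKer hτ (y - x)).comp_sub_const y x).add
    ((hasDerivAt_neg_div_mul_heatKer hτ (y + x)).comp_add_const y x)).sub
    (((((hasDerivAt_tailKer κ hτ (y + x)).const_mul κ).sub
      (hasDerivAt_heatKer hτ (y + x))).comp_add_const y x).const_mul (2 * κ))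

lemma hasDerivAt_robinKer_time (κ x : ℝ) {τ : ℝ} (hτ : 0 < τ) (y : ℝ) :
    HasDerivAt (fun r => robinKer κ x r y) (robinKer₂ κ x τ y / 2) τ := by
  have h := ((hasDerivAt_heatKer_time hτ (y - x)).add (hasDerivAt_heatKer_time hτ (y + x))).sub
    ((hasDerivAt_tailKer_time κ hτ (y + x)).const_mul (2 * κ))
  convert! h using 1
  unfold robinKer₂
  ring

lemma robinKer₁_zero (κ x τ : ℝ) : robinKer₁ κ x τ 0 = κ * robinKer κ x τ 0 := by
  unfold robinKer₁ robinKer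
  rw [zero_sub, zero_add, heatKer_neg]
  ring

lemma continuousOn_heatKer_comp {c : ℝ} :
    ContinuousOn (fun p : ℝ × ℝ => heatKer p.1 (p.2 + c)) (Ioi 0 ×ˢ univ) :=
  continuousOn_heatKer.comp (f := fun p : ℝ × ℝ => (p.1, p.2 + c)) (by fun_prop)
    fun p hp => ⟨hp.1, mem_univ _⟩

lemma continuousOn_tailKer_comp {κ c : ℝ} :
    ContinuousOn (fun p : ℝ × ℝ => tailKer κ p.1 (p.2 + c)) (Ioi 0 ×ˢ univ) :=
  (continuousOn_tailKer κ).comp (f := fun p : ℝ × ℝ => (p.1, p.2 + c)) (by fun_prop)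
    fun p hp => ⟨hp.1, mem_univ _⟩

lemma continuousOn_robinKer (κ x : ℝ) :
    ContinuousOn (fun p : ℝ × ℝ => robinKer κ x p.1 p.2) (Ioi 0 ×ˢ univ) := by
  unfold robinKer
  simp_rw [sub_eq_add_neg _ x]
  exact (continuousOn_heatKer_comp.add continuousOn_heatKer_comp).sub
    (continuousOn_const.mul continuousOn_tailKer_comp)

lemma continuousOn_robinKer₂ (κ x : ℝ) :
    ContinuousOn (fun p : ℝ × ℝ => robinKer₂ κ x p.1 p.2) (Ioi 0 ×ˢ univ) := by
  unfold robinKer₂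
  simp_rw [sub_eq_add_neg _ x]
  have h0 : ∀ p ∈ (Ioi (0 : ℝ) ×ˢ (univ : Set ℝ)), p.1 ≠ 0 := fun p hp => ne_of_gt hp.1
  have h1 : ∀ c : ℝ, ContinuousOn (fun p : ℝ × ℝ => -((p.2 + c) / p.1)) (Ioi 0 ×ˢ univ) :=
    fun c => (ContinuousOn.div (by fun_prop) (by fun_prop) h0).neg
  have h2 : ∀ c : ℝ, ContinuousOn (fun p : ℝ × ℝ => (p.2 + c) ^ 2 / p.1 ^ 2 - 1 / p.1)
      (Ioi 0 ×ˢ univ) := fun c =>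
    (ContinuousOn.div (by fun_prop) (by fun_prop) fun p hp => pow_ne_zero 2 (h0 p hp)).sub
      (ContinuousOn.div (by fun_prop) (by fun_prop) h0)
  exact (((h2 _).mul continuousOn_heatKer_comp).add ((h2 _).mul continuousOn_heatKer_comp)).sub
    (continuousOn_const.mul ((continuousOn_const.mul ((continuousOn_const.mul
      continuousOn_tailKer_comp).sub continuousOn_heatKer_comp)).sub
      ((h1 _).mul continuousOn_heatKer_comp)))

lemma exists_kernel_bound (κ : ℝ) {ε : ℝ} (hε : 0 < ε) (T : ℝ) {B : ℝ} (hB : -κ ≤ B) :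
    ∃ C : ℝ, 0 ≤ C ∧ ∀ τ ∈ Icc ε T, ∀ a : ℝ, heatKer τ a ≤ C * Real.exp (-B * a) ∧
      |a / τ| * heatKer τ a ≤ C * Real.exp (-B * a) ∧ tailKer κ τ a ≤ C * Real.exp (-B * a) := by
  set M : ℝ → ℝ := fun D => Real.exp (D ^ 2 * T / 2) / Real.sqrt ε
  have hM : ∀ D, 0 ≤ M D := fun D => by positivity
  have hsε : 0 < Real.sqrt ε := Real.sqrt_pos.2 hε
  have key : ∀ D, ∀ τ ∈ Icc ε T, ∀ a, heatKer τ a ≤ M D * Real.exp (-D * a) := by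
    intro D τ hτ a
    have hτ0 : 0 < τ := hε.trans_le hτ.1
    refine (heatKer_le hτ0 D a).trans ?_
    rw [Real.exp_add, div_mul_eq_mul_div, mul_comm]
    gcongr
    · exact hτ.2
    · exact hτ.1
  refine ⟨M B + (M (B + 1) + M (B - 1)) / ε + Real.exp (B ^ 2 * T / 2), by positivity, ?_⟩
  intro τ hτ a
  have hτ0 : 0 < τ := hε.trans_le hτ.1
  have e0 : 0 ≤ (M (B + 1) + M (B - 1)) / ε := by positivity
  have e1 : 0 ≤ Real.exp (B ^ 2 * T / 2) := by positivity
  have e2 := hM B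
  refine ⟨(key B τ hτ a).trans ?_, ?_, (tailKer_le hτ0 hB a).trans ?_⟩
  · gcongr
    linarith
  · have h1 : |a| ≤ Real.exp a + Real.exp (-a) := by
      rcases abs_cases a with ⟨h, _⟩ | ⟨h, _⟩ <;> rw [h]
      · linarith [Real.add_one_le_exp a, Real.exp_pos (-a)]
      · linarith [Real.add_one_le_exp (-a), Real.exp_pos a]
    have h2 : |a| * heatKer τ a ≤ (M (B + 1) + M (B - 1)) * Real.exp (-B * a) := by
      calc |a| * heatKer τ a ≤ (Real.exp a + Real.exp (-a)) * heatKer τ a := by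
            gcongr
            exact heatKer_nonneg _ _
        _ = Real.exp a * heatKer τ a + Real.exp (-a) * heatKer τ a := by ring
        _ ≤ Real.exp a * (M (B + 1) * Real.exp (-(B + 1) * a)) +
            Real.exp (-a) * (M (B - 1) * Real.exp (-(B - 1) * a)) := by
            gcongr
            · exact key _ τ hτ a
            · exact key _ τ hτ a
        _ = (M (B + 1) + M (B - 1)) * Real.exp (-B * a) := by
            rw [mul_left_comm, ← Real.exp_add, mul_left_comm, ← Real.exp_add, add_mul]
            congr 3 <;> ring
    calc |a / τ| * heatKer τ a = |a| * heatKer τ a / τ := by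
          rw [abs_div, abs_of_pos hτ0]; ring
      _ ≤ (M (B + 1) + M (B - 1)) * Real.exp (-B * a) / ε := by
          gcongr
          exact hτ.1
      _ = (M (B + 1) + M (B - 1)) / ε * Real.exp (-B * a) := by ring
      _ ≤ _ := by
          gcongr
          linarith
  · rw [add_comm (-B * a), Real.exp_add]
    gcongr
    have : Real.exp (B ^ 2 * τ / 2) ≤ Real.exp (B ^ 2 * T / 2) := by
      gcongr
      exact hτ.2
    linarith

lemma exists_robinKer_bound (κ x : ℝ) {ε : ℝ} (hε : 0 < ε) (T B : ℝ) :
    ∃ C : ℝ, 0 ≤ C ∧ ∀ τ ∈ Icc ε T, ∀ y ≥ (0 : ℝ),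
      |robinKer κ x τ y| ≤ C * Real.exp (-B * y) ∧
      |robinKer₁ κ x τ y| ≤ C * Real.exp (-B * y) := by
  set D := max B (-κ)
  obtain ⟨C, hC0, hC⟩ := exists_kernel_bound κ hε T (le_max_right B (-κ))
  refine ⟨C * (Real.exp (D * x) + Real.exp (-D * x) + 2 * |κ| * Real.exp (-D * x) +
    2 * |κ| * (|κ| + 1) * Real.exp (-D * x)), by positivity, ?_⟩
  intro τ hτ y hy
  have hDy : Real.exp (-D * y) ≤ Real.exp (-B * y) := by
    apply Real.exp_le_exp.2
    nlinarith [le_max_left B (-κ)]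
  have ea : Real.exp (-D * (y - x)) = Real.exp (D * x) * Real.exp (-D * y) := by
    rw [← Real.exp_add]; congr 1; ring
  have eb : Real.exp (-D * (y + x)) = Real.exp (-D * x) * Real.exp (-D * y) := by
    rw [← Real.exp_add]; congr 1; ring
  obtain ⟨a1, a2, -⟩ := hC τ hτ (y - x)
  obtain ⟨b1, b2, b3⟩ := hC τ hτ (y + x)
  rw [ea] at a1 a2
  rw [eb] at b1 b2 b3
  have n1 := heatKer_nonneg τ (y - x)
  have n2 := heatKer_nonneg τ (y + x)
  have n3 := tailKer_nonneg κ τ (y + x)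
  have nk := abs_nonneg κ
  constructor
  · calc |robinKer κ x τ y| ≤ heatKer τ (y - x) + heatKer τ (y + x) +
          2 * |κ| * tailKer κ τ (y + x) := by
          unfold robinKer
          refine (abs_sub _ _).trans ?_
          rw [abs_of_nonneg (add_nonneg n1 n2), abs_mul, abs_mul, abs_of_nonneg n3]
          simp
      _ ≤ C * (Real.exp (D * x) * Real.exp (-D * y)) + C * (Real.exp (-D * x) * Real.exp (-D * y)) +
          2 * |κ| * (C * (Real.exp (-D * x) * Real.exp (-D * y))) := by gcongr
      _ = C * (Real.exp (D * x) + Real.exp (-D * x) + 2 * |κ| * Real.exp (-D * x) + 0) *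
          Real.exp (-D * y) := by ring
      _ ≤ _ := by
          gcongr
          positivity
  · calc |robinKer₁ κ x τ y| ≤ |(y - x) / τ| * heatKer τ (y - x) +
          |(y + x) / τ| * heatKer τ (y + x) +
          2 * |κ| * (|κ| * tailKer κ τ (y + x) + heatKer τ (y + x)) := by
          unfold robinKer₁
          refine (abs_sub _ _).trans (add_le_add ((abs_add_le _ _).trans ?_) ?_)
          · rw [abs_mul, abs_mul, abs_neg, abs_neg, abs_of_nonneg n1, abs_of_nonneg n2]
          · rw [abs_mul, abs_mul, abs_two]
            gcongr
            refine (abs_sub _ _).trans ?_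
            rw [abs_mul, abs_of_nonneg n2, abs_of_nonneg n3]
      _ ≤ C * (Real.exp (D * x) * Real.exp (-D * y)) + C * (Real.exp (-D * x) * Real.exp (-D * y)) +
          2 * |κ| * (|κ| * (C * (Real.exp (-D * x) * Real.exp (-D * y))) +
            C * (Real.exp (-D * x) * Real.exp (-D * y))) := by gcongr
      _ = C * (Real.exp (D * x) + Real.exp (-D * x) + 0 +
          2 * |κ| * (|κ| + 1) * Real.exp (-D * x)) * Real.exp (-D * y) := by ring
      _ ≤ _ := by
          gcongr
          positivity

/-! ### Representation of solutions of the Robin problem for the heat equation -/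

lemma hasDerivAt_integral_of_continuousOn {F F' : ℝ → ℝ → ℝ} {a b c d s : ℝ} (hcd : c ≤ d)
    (hF : ContinuousOn (fun p : ℝ × ℝ => F p.1 p.2) (Ioo a b ×ˢ Icc c d))
    (hF' : ContinuousOn (fun p : ℝ × ℝ => F' p.1 p.2) (Ioo a b ×ˢ Icc c d))
    (hd : ∀ r ∈ Ioo a b, ∀ y ∈ Icc c d, HasDerivAt (fun r => F r y) (F' r y) r)
    (hs : s ∈ Ioo a b) :
    HasDerivAt (fun r => ∫ y in c..d, F r y) (∫ y in c..d, F' s y) s := by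
  obtain ⟨a', ha', has⟩ := exists_between hs.1
  obtain ⟨b', hb's, hb'⟩ := exists_between hs.2
  have hsub : Icc a' b' ⊆ Ioo a b := fun r hr => ⟨ha'.trans_le hr.1, hr.2.trans_lt hb'⟩
  have hslice : ∀ {G : ℝ → ℝ → ℝ}, ContinuousOn (fun p : ℝ × ℝ => G p.1 p.2)
      (Ioo a b ×ˢ Icc c d) → ∀ r ∈ Ioo a b, ContinuousOn (G r) (Icc c d) :=
    fun hG r hr => hG.comp (f := fun y : ℝ => (r, y)) (by fun_prop) fun y hy => ⟨hr, hy⟩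
  have hmeas : ∀ {G : ℝ → ℝ}, ContinuousOn G (Icc c d) →
      AEStronglyMeasurable G (volume.restrict (uIoc c d)) := by
    intro G hG
    rw [uIoc_of_le hcd]
    exact (hG.mono Ioc_subset_Icc_self).aestronglyMeasurable measurableSet_Ioc
  obtain ⟨K, hK⟩ := (isCompact_Icc.prod isCompact_Icc).exists_bound_of_continuousOn
    (hF'.mono (prod_mono hsub Subset.rfl))
  refine (intervalIntegral.hasDerivAt_integral_of_dominated_loc_of_deriv_le (bound := fun _ => K)
    (Icc_mem_nhds has hb's) ?_ ?_ (hmeas (hslice hF' s hs)) ?_ intervalIntegrable_const ?_).2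
  · filter_upwards [Ioo_mem_nhds hs.1 hs.2] with r hr using hmeas (hslice hF r hr)
  · exact (hslice hF s hs).intervalIntegrable_of_Icc hcd
  · refine Eventually.of_forall fun y hy r hr => ?_
    rw [uIoc_of_le hcd] at hy
    exact hK (r, y) ⟨hr, Ioc_subset_Icc_self hy⟩
  · refine Eventually.of_forall fun y hy r hr => ?_
    rw [uIoc_of_le hcd] at hy
    exact hd r (hsub hr) y (Ioc_subset_Icc_self hy)

/-- `w` is a classical solution on `[0, T] × [0, ∞)` of the heat equation `∂ₜ w = ½ ∂_yy w` with
boundary condition `∂_y w = κ w`, having spatial derivatives `w₁`, `w₂` and growing at most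
exponentially. -/
structure IsRobinSolution (κ T C A : ℝ) (w w₁ w₂ : ℝ → ℝ → ℝ) : Prop where
  hasDeriv : ∀ s > 0, ∀ y ≥ 0, HasDerivWithinAt (w s) (w₁ s y) (Ici 0) y
  hasDeriv₁ : ∀ s > 0, ∀ y ≥ 0, HasDerivWithinAt (w₁ s) (w₂ s y) (Ici 0) y
  hasDeriv_time : ∀ s > 0, ∀ y ≥ 0, HasDerivAt (fun r => w r y) (w₂ s y / 2) s
  continuousOn : ContinuousOn (fun p : ℝ × ℝ => w p.1 p.2) (Icc 0 T ×ˢ Ici 0)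
  continuousOn₂ : ContinuousOn (fun p : ℝ × ℝ => w₂ p.1 p.2) (Ioi 0 ×ˢ Ici 0)
  bound : ∀ s ∈ Icc 0 T, ∀ y ≥ 0, |w s y| ≤ C * Real.exp (A * y)
  robin : ∀ s > 0, w₁ s 0 = κ * w s 0

lemma IsRobinSolution.nonneg {κ T C A : ℝ} {w w₁ w₂ : ℝ → ℝ → ℝ}
    (h : IsRobinSolution κ T C A w w₁ w₂) (hT : 0 ≤ T) : 0 ≤ C := by
  have := (abs_nonneg _).trans (h.bound 0 ⟨le_rfl, hT⟩ 0 le_rfl)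
  simpa using this

lemma IsRobinSolution.integral_cutoff {κ T C A x R s τ : ℝ} {w w₁ w₂ : ℝ → ℝ → ℝ}
    (h : IsRobinSolution κ T C A w w₁ w₂) (hR : 0 < R) (hs : s ∈ Ioc 0 T) (hτ : 0 < τ) :
    ∫ y in (0 : ℝ)..R, (1 - (y / R) ^ 2) ^ 2 *
        (w₂ s y / 2 * robinKer κ x τ y - w s y * (robinKer₂ κ x τ y / 2)) =
      ∫ y in (0 : ℝ)..R, w s y * (-(4 * y / R ^ 2) * (1 - (y / R) ^ 2) * robinKer₁ κ x τ y +
        (-2 / R ^ 2 + 6 * y ^ 2 / R ^ 4) * robinKer κ x τ y) := by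
  have hsub : Icc 0 R ⊆ Ici 0 := fun y hy => hy.1
  have cw : ContinuousOn (w s) (Icc 0 R) := fun y hy =>
    ((h.hasDeriv s hs.1 y hy.1).continuousWithinAt).mono hsub
  have cw₁ : ContinuousOn (w₁ s) (Icc 0 R) := fun y hy =>
    ((h.hasDeriv₁ s hs.1 y hy.1).continuousWithinAt).mono hsub
  have cw₂ : ContinuousOn (w₂ s) (Icc 0 R) :=
    h.continuousOn₂.comp (f := fun y : ℝ => (s, y)) (by fun_prop) fun y hy => ⟨hs.1, hy.1⟩
  have cq : Continuous (robinKer κ x τ) := continuous_iff_continuousAt.2 fun y =>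
    (hasDerivAt_robinKer κ x hτ y).continuousAt
  have cq₁ : Continuous (robinKer₁ κ x τ) := continuous_iff_continuousAt.2 fun y =>
    (hasDerivAt_robinKer₁ κ x hτ y).continuousAt
  have cq₂ : Continuous (robinKer₂ κ x τ) := by
    have := (continuousOn_robinKer₂ κ x).comp_continuous (f := fun y : ℝ => (τ, y)) (by fun_prop)
      fun y => ⟨hτ, mem_univ _⟩
    exact this
  have i1 : IntervalIntegrable (fun y => (1 - (y / R) ^ 2) ^ 2 *
      (w₂ s y / 2 * robinKer κ x τ y - w s y * (robinKer₂ κ x τ y / 2))) volume 0 R :=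
    ContinuousOn.intervalIntegrable_of_Icc hR.le (by fun_prop)
  have i2 : IntervalIntegrable (fun y => w s y *
      (-(4 * y / R ^ 2) * (1 - (y / R) ^ 2) * robinKer₁ κ x τ y +
        (-2 / R ^ 2 + 6 * y ^ 2 / R ^ 4) * robinKer κ x τ y)) volume 0 R :=
    ContinuousOn.intervalIntegrable_of_Icc hR.le (by fun_prop)
  rw [← sub_eq_zero, ← intervalIntegral.integral_sub i1 i2]
  rw [intervalIntegral.integral_eq_sub_of_hasDerivAt_of_le (f := fun y =>
    (1 - (y / R) ^ 2) ^ 2 / 2 * (w₁ s y * robinKer κ x τ y - w s y * robinKer₁ κ x τ y) -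
      -(2 * y / R ^ 2) * (1 - (y / R) ^ 2) * (w s y * robinKer κ x τ y)) hR.le (by fun_prop) ?_
      (i1.sub i2)]
  · have : R / R = 1 := div_self hR.ne'
    simp [this, h.robin s hs.1, robinKer₁_zero]
    ring
  · intro y hy
    have hn : Ici (0 : ℝ) ∈ nhds y := Ici_mem_nhds hy.1
    have dw := (h.hasDeriv s hs.1 y hy.1.le).hasDerivAt hn
    have dw₁ := (h.hasDeriv₁ s hs.1 y hy.1.le).hasDerivAt hn
    have dq := hasDerivAt_robinKer κ x hτ y
    have dq₁ := hasDerivAt_robinKer₁ κ x hτ y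
    have d0 : HasDerivAt (fun y : ℝ => 1 - (y / R) ^ 2) (-(2 * y / R ^ 2)) y := by
      have := (((hasDerivAt_id y).div_const R).pow 2).const_sub 1
      convert! this using 1
      simp
      field_simp
    have d1 : HasDerivAt (fun y : ℝ => -(2 * y / R ^ 2)) (-(2 / R ^ 2)) y := by
      have := (((hasDerivAt_id y).const_mul 2).div_const (R ^ 2)).neg
      convert! this using 1
      simp
    have := (((d0.pow 2).div_const 2).mul ((dw₁.mul dq).sub (dw.mul dq₁))).sub
      ((d1.mul d0).mul (dw.mul dq))
    convert! this using 1
    simp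
    field_simp
    ring

lemma IsRobinSolution.hasDerivAt_integral_cutoff {κ t C A x R s : ℝ} {w w₁ w₂ : ℝ → ℝ → ℝ}
    (h : IsRobinSolution κ t C A w w₁ w₂) (hR : 0 < R) (hs : s ∈ Ioo 0 t) :
    HasDerivAt (fun r => ∫ y in (0 : ℝ)..R, (1 - (y / R) ^ 2) ^ 2 *
        (w r y * robinKer κ x (t - r) y))
      (∫ y in (0 : ℝ)..R, w s y *
        (-(4 * y / R ^ 2) * (1 - (y / R) ^ 2) * robinKer₁ κ x (t - s) y +
        (-2 / R ^ 2 + 6 * y ^ 2 / R ^ 4) * robinKer κ x (t - s) y)) s := by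
  rw [← h.integral_cutoff hR ⟨hs.1, hs.2.le⟩ (sub_pos.2 hs.2)]
  have cw : ContinuousOn (fun p : ℝ × ℝ => w p.1 p.2) (Ioo 0 t ×ˢ Icc 0 R) :=
    h.continuousOn.mono (prod_mono Ioo_subset_Icc_self fun y hy => hy.1)
  have cw₂ : ContinuousOn (fun p : ℝ × ℝ => w₂ p.1 p.2) (Ioo 0 t ×ˢ Icc 0 R) :=
    h.continuousOn₂.mono (prod_mono (fun r hr => hr.1) fun y hy => hy.1)
  have cq : ContinuousOn (fun p : ℝ × ℝ => robinKer κ x (t - p.1) p.2) (Ioo 0 t ×ˢ Icc 0 R) :=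
    (continuousOn_robinKer κ x).comp (f := fun p : ℝ × ℝ => (t - p.1, p.2)) (by fun_prop)
      fun p hp => ⟨sub_pos.2 hp.1.2, mem_univ _⟩
  have cq₂ : ContinuousOn (fun p : ℝ × ℝ => robinKer₂ κ x (t - p.1) p.2) (Ioo 0 t ×ˢ Icc 0 R) :=
    (continuousOn_robinKer₂ κ x).comp (f := fun p : ℝ × ℝ => (t - p.1, p.2)) (by fun_prop)
      fun p hp => ⟨sub_pos.2 hp.1.2, mem_univ _⟩
  refine hasDerivAt_integral_of_continuousOn (F := fun r y => (1 - (y / R) ^ 2) ^ 2 *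
        (w r y * robinKer κ x (t - r) y)) (F' := fun r y => (1 - (y / R) ^ 2) ^ 2 *
        (w₂ r y / 2 * robinKer κ x (t - r) y - w r y * (robinKer₂ κ x (t - r) y / 2))) hR.le
    (a := 0) (b := t) (by fun_prop) (by fun_prop) (fun r hr y hy => ?_) hs
  have h1 := (hasDerivAt_robinKer_time κ x (sub_pos.2 hr.2) y).comp_const_sub t r
  have := ((h.hasDeriv_time r hr.1 y hy.1).mul h1).const_mul ((1 - (y / R) ^ 2) ^ 2)
  convert! this using 1
  ring

lemma IsRobinSolution.abs_integral_cutoff_le {κ t C A x R s K B τ : ℝ} {w w₁ w₂ : ℝ → ℝ → ℝ}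
    (h : IsRobinSolution κ t C A w w₁ w₂) (hR : 0 < R) (hs : s ∈ Icc 0 t) (hK : 0 ≤ K)
    (hB : A + 1 ≤ B)
    (hq : ∀ y ≥ (0 : ℝ), |robinKer κ x τ y| ≤ K * Real.exp (-B * y) ∧
      |robinKer₁ κ x τ y| ≤ K * Real.exp (-B * y)) :
    ‖∫ y in (0 : ℝ)..R, w s y *
        (-(4 * y / R ^ 2) * (1 - (y / R) ^ 2) * robinKer₁ κ x τ y +
        (-2 / R ^ 2 + 6 * y ^ 2 / R ^ 4) * robinKer κ x τ y)‖ ≤ 8 * C * K / R := by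
  have hC := h.nonneg (hs.1.trans hs.2)
  have key : ∀ y ∈ uIoc 0 R, ‖w s y *
        (-(4 * y / R ^ 2) * (1 - (y / R) ^ 2) * robinKer₁ κ x τ y +
        (-2 / R ^ 2 + 6 * y ^ 2 / R ^ 4) * robinKer κ x τ y)‖ ≤ 8 * C * K / R ^ 2 := by
    intro y hy
    rw [uIoc_of_le hR.le] at hy
    have hy0 := hy.1.le
    have hyR : 0 ≤ y / R := by positivity
    have hyR1 : y / R ≤ 1 := (div_le_one hR).2 hy.2
    have e1 : |-(4 * y / R ^ 2) * (1 - (y / R) ^ 2)| ≤ 4 * y / R ^ 2 := by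
      rw [abs_mul, abs_neg, abs_of_nonneg (by positivity : 0 ≤ 4 * y / R ^ 2)]
      apply mul_le_of_le_one_right (by positivity)
      rw [abs_le]
      constructor <;> nlinarith
    have e2 : |-2 / R ^ 2 + 6 * y ^ 2 / R ^ 4| ≤ 4 / R ^ 2 := by
      have : -2 / R ^ 2 + 6 * y ^ 2 / R ^ 4 = (-2 + 6 * (y / R) ^ 2) / R ^ 2 := by
        field_simp
      rw [this, abs_div, abs_of_pos (by positivity : 0 < R ^ 2)]
      gcongr
      rw [abs_le]
      constructor <;> nlinarith
    obtain ⟨q0, q1⟩ := hq y hy0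
    rw [Real.norm_eq_abs, abs_mul]
    calc _ ≤ (C * Real.exp (A * y)) * (4 * y / R ^ 2 * (K * Real.exp (-B * y)) +
          4 / R ^ 2 * (K * Real.exp (-B * y))) := by
          gcongr
          · exact h.bound s hs y hy0
          · refine (abs_add_le _ _).trans ?_
            rw [abs_mul, abs_mul _ (robinKer κ x τ y)]
            gcongr
      _ = 4 * C * K / R ^ 2 * ((y + 1) * Real.exp (A * y + -B * y)) := by
          rw [Real.exp_add]; ring
      _ ≤ 4 * C * K / R ^ 2 * 2 := by
          gcongr
          have : Real.exp (A * y + -B * y) ≤ Real.exp (-y) := by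
            apply Real.exp_le_exp.2
            nlinarith
          calc (y + 1) * Real.exp (A * y + -B * y) ≤ Real.exp y * Real.exp (-y) := by
                gcongr
                exact Real.add_one_le_exp y
            _ = 1 := by rw [← Real.exp_add]; simp
            _ ≤ 2 := by norm_num
      _ = _ := by ring
  refine (intervalIntegral.norm_integral_le_of_norm_le_const key).trans (le_of_eq ?_)
  rw [sub_zero, abs_of_pos hR]
  field_simp

lemma integrableOn_Ioi_zero_exp_neg : IntegrableOn (fun y : ℝ => Real.exp (-y)) (Ioi 0) := by
  simpa using exp_neg_integrableOn_Ioi 0 one_pos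

lemma IsRobinSolution.norm_mul_le {κ t C A s K B y k : ℝ} {w w₁ w₂ : ℝ → ℝ → ℝ}
    (h : IsRobinSolution κ t C A w w₁ w₂) (hs : s ∈ Icc 0 t)
    (hB : A + 1 ≤ B) (hy : 0 ≤ y) (hk : |k| ≤ K * Real.exp (-B * y)) :
    ‖w s y * k‖ ≤ C * K * Real.exp (-y) := by
  have hC := h.nonneg (hs.1.trans hs.2)
  have hK : 0 ≤ K := by
    have := (abs_nonneg _).trans hk
    exact nonneg_of_mul_nonneg_left this (Real.exp_pos _)
  rw [Real.norm_eq_abs, abs_mul]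
  calc _ ≤ (C * Real.exp (A * y)) * (K * Real.exp (-B * y)) := by
        gcongr
        exact h.bound s hs y hy
    _ = C * K * Real.exp (A * y + -B * y) := by rw [Real.exp_add]; ring
    _ ≤ _ := by
        gcongr
        nlinarith

lemma IsRobinSolution.continuousOn_slice {κ t C A s : ℝ} {w w₁ w₂ : ℝ → ℝ → ℝ}
    (h : IsRobinSolution κ t C A w w₁ w₂) (hs : s ∈ Icc 0 t) : ContinuousOn (w s) (Ioi 0) :=
  h.continuousOn.comp (f := fun y : ℝ => (s, y)) (by fun_prop)
    fun _ hy => ⟨hs, mem_Ici.2 (le_of_lt hy)⟩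

lemma IsRobinSolution.aestronglyMeasurable_mul {κ t C A s : ℝ} {w w₁ w₂ : ℝ → ℝ → ℝ}
    (h : IsRobinSolution κ t C A w w₁ w₂) (hs : s ∈ Icc 0 t) {k : ℝ → ℝ} (hk : Continuous k) :
    AEStronglyMeasurable (fun y => w s y * k y) (volume.restrict (Ioi 0)) :=
  ((h.continuousOn_slice hs).mul hk.continuousOn).aestronglyMeasurable measurableSet_Ioi

lemma IsRobinSolution.integrableOn_mul {κ t C A s K : ℝ} {w w₁ w₂ : ℝ → ℝ → ℝ}
    (h : IsRobinSolution κ t C A w w₁ w₂) (hs : s ∈ Icc 0 t) {k : ℝ → ℝ} (hk : Continuous k)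
    {B : ℝ} (hB : A + 1 ≤ B) (hK : ∀ y ≥ (0 : ℝ), |k y| ≤ K * Real.exp (-B * y)) :
    IntegrableOn (fun y => w s y * k y) (Ioi 0) := by
  refine (integrableOn_Ioi_zero_exp_neg.const_mul (C * K)).mono'
    (h.aestronglyMeasurable_mul hs hk) ?_
  filter_upwards [ae_restrict_mem measurableSet_Ioi] with y hy
  exact h.norm_mul_le hs hB (le_of_lt hy) (hK y (le_of_lt hy))

lemma continuous_heatKer {τ : ℝ} (hτ : 0 < τ) : Continuous (heatKer τ) :=
  continuous_iff_continuousAt.2 fun y => (hasDerivAt_heatKer hτ y).continuousAt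

lemma continuous_tailKer (κ : ℝ) {τ : ℝ} (hτ : 0 < τ) : Continuous (tailKer κ τ) :=
  continuous_iff_continuousAt.2 fun y => (hasDerivAt_tailKer κ hτ y).continuousAt

lemma continuous_robinKer (κ x : ℝ) {τ : ℝ} (hτ : 0 < τ) : Continuous (robinKer κ x τ) :=
  continuous_iff_continuousAt.2 fun y => (hasDerivAt_robinKer κ x hτ y).continuousAt

lemma IsRobinSolution.tendsto_integral_cutoff {κ t C A x s : ℝ} {w w₁ w₂ : ℝ → ℝ → ℝ}
    (h : IsRobinSolution κ t C A w w₁ w₂) (hs : s ∈ Ioo 0 t) :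
    Tendsto (fun n : ℕ => ∫ y in (0 : ℝ)..(n + 1 : ℝ), (1 - (y / (n + 1 : ℝ)) ^ 2) ^ 2 *
        (w s y * robinKer κ x (t - s) y)) atTop
      (nhds (∫ y in Ioi 0, w s y * robinKer κ x (t - s) y)) := by
  have hτ : 0 < t - s := sub_pos.2 hs.2
  obtain ⟨K, hK0, hK⟩ := exists_robinKer_bound κ x hτ (t - s) (A + 1)
  have hrw : ∀ n : ℕ, ∫ y in (0 : ℝ)..(n + 1 : ℝ), (1 - (y / (n + 1 : ℝ)) ^ 2) ^ 2 *
        (w s y * robinKer κ x (t - s) y) = ∫ y in Ioi 0, (Iic (n + 1 : ℝ)).indicator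
          (fun y => (1 - (y / (n + 1 : ℝ)) ^ 2) ^ 2 * (w s y * robinKer κ x (t - s) y)) y := by
    intro n
    rw [intervalIntegral.integral_of_le (by positivity), setIntegral_indicator measurableSet_Iic]
    rfl
  simp_rw [hrw]
  have hm := h.aestronglyMeasurable_mul ⟨hs.1.le, hs.2.le⟩ (continuous_robinKer κ x hτ)
  refine tendsto_integral_of_dominated_convergence (fun y => C * K * Real.exp (-y))
    (fun n => ?_) (integrableOn_Ioi_zero_exp_neg.const_mul _) (fun n => ?_) ?_
  · refine AEStronglyMeasurable.indicator (AEStronglyMeasurable.mul ?_ hm) measurableSet_Iic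
    exact Continuous.aestronglyMeasurable (by fun_prop)
  · filter_upwards [ae_restrict_mem measurableSet_Ioi] with y hy
    have hy0 : 0 ≤ y := le_of_lt hy
    have hb := h.norm_mul_le ⟨hs.1.le, hs.2.le⟩ le_rfl hy0
      (hK _ (right_mem_Icc.2 le_rfl) y hy0).1
    by_cases hyn : y ∈ Iic (n + 1 : ℝ)
    · rw [indicator_of_mem hyn, norm_mul]
      refine (mul_le_of_le_one_left (norm_nonneg _) ?_).trans hb
      have h0 : 0 ≤ y / (n + 1 : ℝ) := by positivity
      have h1 : y / (n + 1 : ℝ) ≤ 1 := (div_le_one (by positivity)).2 hyn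
      rw [norm_pow, Real.norm_eq_abs]
      refine pow_le_one₀ (abs_nonneg _) ?_
      rw [abs_le]
      constructor <;> nlinarith
    · rw [indicator_of_notMem hyn, norm_zero]
      exact (norm_nonneg _).trans hb
  · refine Eventually.of_forall fun y => ?_
    have h1 : Tendsto (fun n : ℕ => y / (n + 1 : ℝ)) atTop (nhds 0) :=
      tendsto_const_nhds.div_atTop
        (tendsto_atTop_add_const_right _ _ tendsto_natCast_atTop_atTop)
    have h2 : Tendsto (fun n : ℕ => (1 - (y / (n + 1 : ℝ)) ^ 2) ^ 2 *
        (w s y * robinKer κ x (t - s) y)) atTop (nhds (w s y * robinKer κ x (t - s) y)) := by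
      have := (((h1.pow 2).const_sub 1).pow 2).mul_const (w s y * robinKer κ x (t - s) y)
      simpa using this
    refine h2.congr' ?_
    filter_upwards [tendsto_natCast_atTop_atTop.eventually_ge_atTop y] with n hn
    rw [indicator_of_mem]
    exact hn.trans (by linarith)

lemma IsRobinSolution.integral_eq {κ t C A x s₁ s₂ : ℝ} {w w₁ w₂ : ℝ → ℝ → ℝ}
    (h : IsRobinSolution κ t C A w w₁ w₂) (h1 : 0 < s₁) (h12 : s₁ ≤ s₂) (h2 : s₂ < t) :
    ∫ y in Ioi 0, w s₂ y * robinKer κ x (t - s₂) y =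
      ∫ y in Ioi 0, w s₁ y * robinKer κ x (t - s₁) y := by
  obtain ⟨K, hK0, hK⟩ := exists_robinKer_bound κ x (sub_pos.2 h2) t (A + 1)
  have hlim := (h.tendsto_integral_cutoff (x := x) ⟨h1.trans_le h12, h2⟩).sub
    (h.tendsto_integral_cutoff (x := x) ⟨h1, h12.trans_lt h2⟩)
  have hzero : Tendsto (fun n : ℕ => 8 * C * K / (n + 1 : ℝ) * (s₂ - s₁)) atTop (nhds 0) := by
    have : Tendsto (fun n : ℕ => 8 * C * K / (n + 1 : ℝ)) atTop (nhds 0) :=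
      tendsto_const_nhds.div_atTop
        (tendsto_atTop_add_const_right _ _ tendsto_natCast_atTop_atTop)
    simpa using this.mul_const (s₂ - s₁)
  rw [← sub_eq_zero]
  refine tendsto_nhds_unique hlim (squeeze_zero_norm (fun n => ?_) hzero)
  have hR : (0 : ℝ) < n + 1 := by positivity
  refine norm_image_sub_le_of_norm_deriv_le_segment' (f := fun r => ∫ y in (0 : ℝ)..(n + 1 : ℝ),
    (1 - (y / (n + 1 : ℝ)) ^ 2) ^ 2 * (w r y * robinKer κ x (t - r) y))
    (fun s hs => (h.hasDerivAt_integral_cutoff hR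
      ⟨h1.trans_le hs.1, hs.2.trans_lt h2⟩).hasDerivWithinAt) (fun s hs => ?_) s₂
    (right_mem_Icc.2 h12)
  refine h.abs_integral_cutoff_le hR ⟨h1.le.trans hs.1, (hs.2.trans h2).le⟩ hK0 le_rfl
    fun y hy => hK _ ⟨?_, ?_⟩ y hy
  · linarith [hs.2]
  · linarith [hs.1]

lemma IsRobinSolution.tendsto_integral_zero {κ t C A x : ℝ} {w w₁ w₂ : ℝ → ℝ → ℝ}
    (h : IsRobinSolution κ t C A w w₁ w₂) (ht : 0 < t) :
    Tendsto (fun s => ∫ y in Ioi 0, w s y * robinKer κ x (t - s) y) (nhdsWithin 0 (Ioi 0))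
      (nhds (∫ y in Ioi 0, w 0 y * robinKer κ x t y)) := by
  obtain ⟨K, hK0, hK⟩ := exists_robinKer_bound κ x (half_pos ht) t (A + 1)
  have hev : ∀ᶠ s in nhdsWithin (0 : ℝ) (Ioi 0), s ∈ Ioo 0 (t / 2) :=
    Ioo_mem_nhdsGT (half_pos ht)
  refine tendsto_integral_filter_of_dominated_convergence (fun y => C * K * Real.exp (-y))
    ?_ ?_ (integrableOn_Ioi_zero_exp_neg.const_mul _) ?_
  · filter_upwards [hev] with s hs
    exact h.aestronglyMeasurable_mul ⟨hs.1.le, by linarith [hs.2]⟩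
      (continuous_robinKer κ x (by linarith [hs.2]))
  · filter_upwards [hev] with s hs
    filter_upwards [ae_restrict_mem measurableSet_Ioi] with y hy
    exact h.norm_mul_le ⟨hs.1.le, by linarith [hs.2]⟩ le_rfl (le_of_lt hy)
      (hK _ ⟨by linarith [hs.2], by linarith [hs.1]⟩ y (le_of_lt hy)).1
  · filter_upwards [ae_restrict_mem measurableSet_Ioi] with y hy
    have hy0 : 0 ≤ y := le_of_lt hy
    have c1 : Tendsto (fun s => w s y) (nhdsWithin 0 (Ioi 0)) (nhds (w 0 y)) := by
      have hc : ContinuousOn (fun s => w s y) (Icc 0 t) :=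
        h.continuousOn.comp (f := fun s : ℝ => (s, y)) (by fun_prop) fun s hs => ⟨hs, hy0⟩
      have := hc 0 ⟨le_rfl, ht.le⟩
      exact this.tendsto.mono_left (nhdsWithin_le_of_mem
        (mem_of_superset (Ioo_mem_nhdsGT ht) Ioo_subset_Icc_self))
    have c2 : Tendsto (fun s => robinKer κ x (t - s) y) (nhdsWithin 0 (Ioi 0))
        (nhds (robinKer κ x t y)) := by
      have hc : ContinuousAt (fun s => robinKer κ x (t - s) y) 0 := by
        have h1 := (hasDerivAt_robinKer_time κ x (τ := t - 0) (by linarith) y).comp_const_sub t 0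
        exact h1.continuousAt
      have := hc.tendsto
      rw [sub_zero] at this
      exact this.mono_left nhdsWithin_le_nhds
    exact c1.mul c2

lemma tendsto_sub_nhdsLT (t : ℝ) :
    Tendsto (fun s => t - s) (nhdsWithin t (Iio t)) (nhdsWithin 0 (Ioi 0)) := by
  refine tendsto_nhdsWithin_iff.2 ⟨?_, ?_⟩
  · have : Continuous fun s => t - s := by fun_prop
    have h := this.tendsto t
    rw [sub_self] at h
    exact h.mono_left nhdsWithin_le_nhds
  · filter_upwards [self_mem_nhdsWithin] with s hs
    exact mem_Ioi.2 (sub_pos.2 (mem_Iio.1 hs))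

lemma integral_mul_heatKer {τ : ℝ} (hτ : 0 < τ) (h : ℝ → ℝ) (c : ℝ) :
    ∫ y, h y * heatKer τ (y - c) = ∫ z, h (c + Real.sqrt τ * z) * phi z := by
  have hs : 0 < Real.sqrt τ := Real.sqrt_pos.2 hτ
  have h1 : ∫ y, h y * heatKer τ (y - c) = ∫ y, h (c + y) * heatKer τ y := by
    rw [← integral_add_left_eq_self (fun y => h y * heatKer τ (y - c)) c]
    simp
  have h2 := Measure.integral_comp_mul_left (fun y => h (c + y) * heatKer τ y) (Real.sqrt τ)
  rw [smul_eq_mul, abs_of_pos (inv_pos.2 hs)] at h2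
  rw [h1]
  have h3 : ∫ y, h (c + y) * heatKer τ y = Real.sqrt τ *
      ∫ z, h (c + Real.sqrt τ * z) * heatKer τ (Real.sqrt τ * z) := by
    rw [h2, ← mul_assoc, mul_inv_cancel₀ hs.ne', one_mul]
  rw [h3, ← integral_const_mul]
  congr 1
  ext z
  unfold heatKer
  rw [mul_div_cancel_left₀ z hs.ne']
  field_simp

lemma tendsto_integral_mul_heatKer {t c C A L : ℝ} (hA : 0 ≤ A) {h : ℝ → ℝ → ℝ}
    (hm : ∀ᶠ s in nhdsWithin t (Iio t), Measurable (h s))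
    (hb : ∀ᶠ s in nhdsWithin t (Iio t), ∀ y, |h s y| ≤ C * Real.exp (A * |y|))
    (hL : Tendsto (fun p : ℝ × ℝ => h p.1 p.2) (nhdsWithin t (Iio t) ×ˢ nhds c) (nhds L)) :
    Tendsto (fun s => ∫ y, h s y * heatKer (t - s) (y - c)) (nhdsWithin t (Iio t)) (nhds L) := by
  have hτ : ∀ᶠ s in nhdsWithin t (Iio t), 0 < t - s ∧ t - s < 1 := by
    filter_upwards [(tendsto_sub_nhdsLT t).eventually (Ioo_mem_nhdsGT one_pos)] with s hs using hs
  have heq : ∀ᶠ s in nhdsWithin t (Iio t), ∫ z, h s (c + Real.sqrt (t - s) * z) * phi z =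
      ∫ y, h s y * heatKer (t - s) (y - c) := by
    filter_upwards [hτ] with s hs using (integral_mul_heatKer hs.1 (h s) c).symm
  refine Tendsto.congr' heq ?_
  have hlim : L = ∫ z, L * phi z := by rw [integral_const_mul, integral_phi, mul_one]
  rw [hlim]
  refine tendsto_integral_filter_of_dominated_convergence
    (fun z => C * Real.exp (A * |c|) * (Real.exp (A * |z|) * phi z)) ?_ ?_
    ((integrable_exp_abs_mul_phi A).const_mul _) ?_
  · filter_upwards [hm] with s hs
    refine Measurable.aestronglyMeasurable ((hs.comp ?_).mul continuous_phi.measurable)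
    fun_prop
  · filter_upwards [hb, hτ] with s hs hs1
    refine Eventually.of_forall fun z => ?_
    rw [norm_mul, Real.norm_eq_abs, Real.norm_of_nonneg (phi_nonneg z), ← mul_assoc]
    refine mul_le_mul_of_nonneg_right ?_ (phi_nonneg z)
    have hC : 0 ≤ C := by simpa using (abs_nonneg _).trans (hs 0)
    refine (hs _).trans ?_
    rw [mul_assoc, ← Real.exp_add, ← mul_add]
    gcongr
    refine (abs_add_le _ _).trans ?_
    rw [abs_mul, abs_of_nonneg (Real.sqrt_nonneg _)]
    gcongr
    exact mul_le_of_le_one_left (abs_nonneg z) (Real.sqrt_le_one.2 hs1.2.le)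
  · refine Eventually.of_forall fun z => ?_
    refine Tendsto.mul_const _ (hL.comp (tendsto_id.prodMk ?_))
    have h1 : Continuous fun s => c + Real.sqrt (t - s) * z := by fun_prop
    have h2 := h1.tendsto t
    simp only [sub_self, Real.sqrt_zero, zero_mul, add_zero] at h2
    exact h2.mono_left nhdsWithin_le_nhds

lemma tendsto_tailKer (κ t : ℝ) {a : ℝ} (ha : 0 < a) :
    Tendsto (fun s => tailKer κ (t - s) a) (nhdsWithin t (Iio t)) (nhds 0) := by
  have h1 : Tendsto (fun τ => tailKer κ τ a) (nhdsWithin 0 (Ioi 0)) (nhds 0) := by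
    unfold tailKer
    have e1 : Tendsto (fun τ => Real.exp (κ * a + κ ^ 2 * τ / 2)) (nhdsWithin 0 (Ioi 0))
        (nhds (Real.exp (κ * a + κ ^ 2 * 0 / 2))) :=
      ((by fun_prop : Continuous fun τ => Real.exp (κ * a + κ ^ 2 * τ / 2)).tendsto 0).mono_left
        nhdsWithin_le_nhds
    have e2 : Tendsto (fun τ => (a + κ * τ) / Real.sqrt τ) (nhdsWithin 0 (Ioi 0)) atTop := by
      have n1 : Tendsto (fun τ => a + κ * τ) (nhdsWithin 0 (Ioi 0)) (nhds (a + κ * 0)) :=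
        ((by fun_prop : Continuous fun τ => a + κ * τ).tendsto 0).mono_left nhdsWithin_le_nhds
      have n2 : Tendsto Real.sqrt (nhdsWithin 0 (Ioi 0)) (nhdsWithin 0 (Ioi 0)) := by
        refine tendsto_nhdsWithin_iff.2 ⟨?_, ?_⟩
        · have := Real.continuous_sqrt.tendsto 0
          rw [Real.sqrt_zero] at this
          exact this.mono_left nhdsWithin_le_nhds
        · filter_upwards [self_mem_nhdsWithin] with s hs
          exact Real.sqrt_pos.2 hs
      have n3 := (tendsto_inv_nhdsGT_zero (𝕜 := ℝ)).comp n2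
      exact n1.pos_mul_atTop (by simpa using ha) n3
    simpa using e1.mul (tendsto_Psi_atTop.comp e2)
  exact h1.comp (tendsto_sub_nhdsLT t)

lemma IsRobinSolution.tendsto_integral_tailKer {κ t C A x : ℝ} {w w₁ w₂ : ℝ → ℝ → ℝ}
    (h : IsRobinSolution κ t C A w w₁ w₂) (ht : 0 < t) (hx : 0 < x) :
    Tendsto (fun s => ∫ y in Ioi 0, w s y * tailKer κ (t - s) (y + x)) (nhdsWithin t (Iio t))
      (nhds 0) := by
  set B := max (A + 1) (-κ)
  have hev : ∀ᶠ s in nhdsWithin t (Iio t), s ∈ Ioo 0 t := Ioo_mem_nhdsLT ht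
  rw [show nhds (0 : ℝ) = nhds (∫ y in Ioi (0 : ℝ), (0 : ℝ)) by simp]
  refine tendsto_integral_filter_of_dominated_convergence
    (fun y => C * Real.exp (-B * x + B ^ 2 * t / 2) * Real.exp (-y))
    ?_ ?_ (integrableOn_Ioi_zero_exp_neg.const_mul _) ?_
  · filter_upwards [hev] with s hs
    exact h.aestronglyMeasurable_mul ⟨hs.1.le, hs.2.le⟩
      ((continuous_tailKer κ (sub_pos.2 hs.2)).comp (continuous_add_const x))
  · filter_upwards [hev] with s hs
    filter_upwards [ae_restrict_mem measurableSet_Ioi] with y hy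
    refine h.norm_mul_le ⟨hs.1.le, hs.2.le⟩ (le_max_left (A + 1) (-κ)) (le_of_lt hy) ?_
    rw [abs_of_nonneg (tailKer_nonneg _ _ _)]
    refine (tailKer_le (sub_pos.2 hs.2) (le_max_right (A + 1) (-κ)) _).trans ?_
    rw [← Real.exp_add]
    apply Real.exp_le_exp.2
    have := mul_nonneg (sq_nonneg B) hs.1.le
    change -B * (y + x) + B ^ 2 * (t - s) / 2 ≤ -B * x + B ^ 2 * t / 2 + -B * y
    linarith
  · filter_upwards [ae_restrict_mem measurableSet_Ioi] with y hy
    have hev2 : ∀ᶠ s in nhdsWithin t (Iio t), ‖w s y * tailKer κ (t - s) (y + x)‖ ≤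
        C * Real.exp (A * y) * tailKer κ (t - s) (y + x) := by
      filter_upwards [hev] with s hs
      rw [norm_mul, Real.norm_eq_abs, Real.norm_of_nonneg (tailKer_nonneg _ _ _)]
      exact mul_le_mul_of_nonneg_right (h.bound s ⟨hs.1.le, hs.2.le⟩ y (le_of_lt hy))
        (tailKer_nonneg _ _ _)
    refine squeeze_zero_norm' hev2 ?_
    simpa using (tendsto_tailKer κ t (add_pos hy hx)).const_mul (C * Real.exp (A * y))

lemma IsRobinSolution.tendsto_integral_heatKer {κ t C A c L : ℝ} {w w₁ w₂ : ℝ → ℝ → ℝ}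
    (h : IsRobinSolution κ t C A w w₁ w₂) (ht : 0 < t)
    (hL : Tendsto (fun p : ℝ × ℝ => (Ioi 0).indicator (w p.1) p.2)
      (nhdsWithin t (Iio t) ×ˢ nhds c) (nhds L)) :
    Tendsto (fun s => ∫ y in Ioi 0, w s y * heatKer (t - s) (y - c)) (nhdsWithin t (Iio t))
      (nhds L) := by
  have hev : ∀ᶠ s in nhdsWithin t (Iio t), s ∈ Ioo 0 t := Ioo_mem_nhdsLT ht
  have hC := h.nonneg ht.le
  have := tendsto_integral_mul_heatKer (C := C) (abs_nonneg A)
    (h := fun s => (Ioi 0).indicator (w s)) ?_ ?_ hL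
  · refine this.congr fun s => ?_
    rw [← integral_indicator measurableSet_Ioi]
    congr 1
    ext y
    by_cases hy : y ∈ Ioi (0 : ℝ)
    · rw [indicator_of_mem hy, indicator_of_mem hy]
    · rw [indicator_of_notMem hy, indicator_of_notMem hy, zero_mul]
  · filter_upwards [hev] with s hs
    classical
    have := ContinuousOn.measurable_piecewise (g := fun _ => (0 : ℝ))
      (h.continuousOn_slice ⟨hs.1.le, hs.2.le⟩) continuousOn_const measurableSet_Ioi
    exact this
  · filter_upwards [hev] with s hs y
    by_cases hy : y ∈ Ioi (0 : ℝ)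
    · rw [indicator_of_mem hy]
      refine (h.bound s ⟨hs.1.le, hs.2.le⟩ y (le_of_lt hy)).trans ?_
      refine mul_le_mul_of_nonneg_left (Real.exp_le_exp.2 ?_) hC
      rw [← abs_mul]
      exact le_abs_self _
    · rw [indicator_of_notMem hy, abs_zero]
      positivity

lemma IsRobinSolution.tendsto_indicator_pos {κ t C A x : ℝ} {w w₁ w₂ : ℝ → ℝ → ℝ}
    (h : IsRobinSolution κ t C A w w₁ w₂) (ht : 0 < t) (hx : 0 < x) :
    Tendsto (fun p : ℝ × ℝ => (Ioi 0).indicator (w p.1) p.2)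
      (nhdsWithin t (Iio t) ×ˢ nhds x) (nhds (w t x)) := by
  have hc := (h.continuousOn (t, x) ⟨⟨ht.le, le_rfl⟩, hx.le⟩).tendsto
  have hle : nhdsWithin t (Iio t) ×ˢ nhds x ≤ nhdsWithin (t, x) (Icc 0 t ×ˢ Ici 0) := by
    rw [nhdsWithin_prod_eq]
    refine Filter.prod_mono ?_ ?_
    · exact nhdsWithin_le_of_mem (mem_of_superset (Ioo_mem_nhdsLT ht) Ioo_subset_Icc_self)
    · exact le_inf le_rfl (le_principal_iff.2 (Ici_mem_nhds hx))
  refine (hc.mono_left hle).congr' ?_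
  filter_upwards [(tendsto_snd.eventually (Ioi_mem_nhds hx) :
    ∀ᶠ p in nhdsWithin t (Iio t) ×ˢ nhds x, p.2 ∈ Ioi 0)] with p hp
  rw [indicator_of_mem hp]

lemma tendsto_indicator_neg {t x : ℝ} (w : ℝ → ℝ → ℝ) (hx : 0 < x) :
    Tendsto (fun p : ℝ × ℝ => (Ioi 0).indicator (w p.1) p.2)
      (nhdsWithin t (Iio t) ×ˢ nhds (-x)) (nhds 0) := by
  refine tendsto_const_nhds.congr' ?_
  filter_upwards [(tendsto_snd.eventually (Iio_mem_nhds (neg_neg_of_pos hx)) :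
    ∀ᶠ p in nhdsWithin t (Iio t) ×ˢ nhds (-x), p.2 ∈ Iio 0)] with p hp
  rw [indicator_of_notMem (by simpa using le_of_lt hp)]

lemma IsRobinSolution.tendsto_integral_terminal {κ t C A x : ℝ} {w w₁ w₂ : ℝ → ℝ → ℝ}
    (h : IsRobinSolution κ t C A w w₁ w₂) (ht : 0 < t) (hx : 0 < x) :
    Tendsto (fun s => ∫ y in Ioi 0, w s y * robinKer κ x (t - s) y) (nhdsWithin t (Iio t))
      (nhds (w t x)) := by
  have h1 := h.tendsto_integral_heatKer ht (h.tendsto_indicator_pos ht hx)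
  have h2 := h.tendsto_integral_heatKer ht (tendsto_indicator_neg w hx)
  have h3 := (h.tendsto_integral_tailKer ht hx).const_mul (2 * κ)
  have h4 := (h1.add h2).sub h3
  rw [add_zero, mul_zero, sub_zero] at h4
  refine h4.congr' ?_
  filter_upwards [Ioo_mem_nhdsLT ht] with s hs
  have hτ : 0 < t - s := sub_pos.2 hs.2
  set B := max (A + 1) (-κ)
  obtain ⟨K, hK0, hK⟩ := exists_kernel_bound κ hτ (t - s) (le_max_right (A + 1) (-κ))
  have shift : ∀ c y : ℝ, K * Real.exp (-B * (y + c)) = K * Real.exp (-B * c) *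
      Real.exp (-B * y) := by
    intro c y
    rw [mul_assoc, ← Real.exp_add]
    congr 2
    ring
  have hmem : s ∈ Icc 0 t := ⟨hs.1.le, hs.2.le⟩
  have hh : ∀ c : ℝ, IntegrableOn (fun y => w s y * heatKer (t - s) (y + c)) (Ioi 0) := fun c =>
    h.integrableOn_mul hmem ((continuous_heatKer hτ).comp (continuous_add_const c))
      (le_max_left (A + 1) (-κ)) fun y _ => by
        rw [abs_of_nonneg (heatKer_nonneg _ _)]
        exact ((hK _ (right_mem_Icc.2 le_rfl) _).1).trans (shift c y).le
  have ht : IntegrableOn (fun y => w s y * tailKer κ (t - s) (y + x)) (Ioi 0) :=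
    h.integrableOn_mul hmem ((continuous_tailKer κ hτ).comp (continuous_add_const x))
      (le_max_left (A + 1) (-κ)) fun y _ => by
        rw [abs_of_nonneg (tailKer_nonneg _ _ _)]
        exact ((hK _ (right_mem_Icc.2 le_rfl) _).2.2).trans (shift x y).le
  simp_rw [sub_neg_eq_add, sub_eq_add_neg _ x]
  have e1 := integral_add (hh (-x)) (hh x)
  have e2 := integral_sub ((hh (-x)).add (hh x)) (ht.const_mul (2 * κ))
  rw [integral_const_mul] at e2
  simp only [Pi.add_apply] at e2
  rw [← e1, ← e2]
  congr 1
  ext y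
  unfold robinKer
  rw [sub_eq_add_neg y x]
  ring

theorem IsRobinSolution.eq_integral {κ t C A x : ℝ} {w w₁ w₂ : ℝ → ℝ → ℝ}
    (h : IsRobinSolution κ t C A w w₁ w₂) (ht : 0 < t) (hx : 0 < x) :
    w t x = ∫ y in Ioi 0, w 0 y * robinKer κ x t y := by
  set Φ : ℝ → ℝ := fun s => ∫ y in Ioi 0, w s y * robinKer κ x (t - s) y
  have hconst : ∀ s ∈ Ioo 0 t, Φ s = Φ (t / 2) := by
    intro s hs
    rcases le_total s (t / 2) with hle | hle
    · exact (h.integral_eq hs.1 hle (by linarith)).symm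
    · exact h.integral_eq (by linarith) hle hs.2
  have e1 : w t x = Φ (t / 2) := by
    refine tendsto_nhds_unique (h.tendsto_integral_terminal ht hx)
      (tendsto_const_nhds.congr' ?_)
    filter_upwards [Ioo_mem_nhdsLT ht] with s hs using (hconst s hs).symm
  have e2 : ∫ y in Ioi 0, w 0 y * robinKer κ x t y = Φ (t / 2) := by
    refine tendsto_nhds_unique (h.tendsto_integral_zero ht) (tendsto_const_nhds.congr' ?_)
    filter_upwards [Ioo_mem_nhdsGT ht] with s hs using (hconst s hs).symm
  rw [e1, e2]

/-! ### Regularity of solutions and reduction to the Robin problem -/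

lemma hasDerivWithinAt_snd_of_differentiableOn {g : ℝ × ℝ → ℝ}
    (hg : DifferentiableOn ℝ g (Ioi 0 ×ˢ Ici 0)) {s y : ℝ} (hs : 0 < s) (hy : 0 ≤ y) :
    HasDerivWithinAt (fun z => g (s, z)) (fderivWithin ℝ g (Ioi 0 ×ˢ Ici 0) (s, y) (0, 1))
      (Ici 0) y := by
  have h1 : HasDerivWithinAt (fun z : ℝ => (s, z)) ((0 : ℝ), (1 : ℝ)) (Ici 0) y :=
    (hasDerivWithinAt_const y _ s).prodMk (hasDerivWithinAt_id y _)
  exact (hg (s, y) ⟨hs, hy⟩).hasFDerivWithinAt.comp_hasDerivWithinAt y h1 fun z hz => ⟨hs, hz⟩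

lemma hasDerivAt_fst_of_differentiableOn {g : ℝ × ℝ → ℝ}
    (hg : DifferentiableOn ℝ g (Ioi 0 ×ˢ Ici 0)) {s y : ℝ} (hs : 0 < s) (hy : 0 ≤ y) :
    HasDerivAt (fun r => g (r, y)) (fderivWithin ℝ g (Ioi 0 ×ˢ Ici 0) (s, y) (1, 0)) s := by
  have h1 : HasDerivWithinAt (fun r : ℝ => (r, y)) ((1 : ℝ), (0 : ℝ)) (Ioi 0) s :=
    (hasDerivWithinAt_id s _).prodMk (hasDerivWithinAt_const s _ y)
  have h2 : MapsTo (fun r : ℝ => (r, y)) (Ioi 0) (Ioi 0 ×ˢ Ici 0) := fun r hr => ⟨hr, hy⟩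
  exact ((hg (s, y) ⟨hs, hy⟩).hasFDerivWithinAt.comp_hasDerivWithinAt s h1 h2).hasDerivAt
    (Ioi_mem_nhds hs)

lemma uniqueDiffOn_Ioi_prod_Ici : UniqueDiffOn ℝ (Ioi (0 : ℝ) ×ˢ Ici (0 : ℝ)) :=
  isOpen_Ioi.uniqueDiffOn.prod (uniqueDiffOn_Ici 0)

lemma contDiffOn_fderivWithin_const_apply {g : ℝ × ℝ → ℝ}
    (hg : ContDiffOn ℝ (⊤ : ℕ∞) g (Ioi 0 ×ˢ Ici 0)) (e : ℝ × ℝ) :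
    ContDiffOn ℝ (⊤ : ℕ∞) (fun p => fderivWithin ℝ g (Ioi 0 ×ˢ Ici 0) p e) (Ioi 0 ×ˢ Ici 0) :=
  (hg.fderivWithin uniqueDiffOn_Ioi_prod_Ici (by simp)).clm_apply contDiffOn_const

lemma fderivWithin_fderivWithin_apply_comm {g : ℝ × ℝ → ℝ}
    (hg : ContDiffOn ℝ (⊤ : ℕ∞) g (Ioi 0 ×ˢ Ici 0)) (d e : ℝ × ℝ) {p : ℝ × ℝ}
    (hp : p ∈ Ioi (0 : ℝ) ×ˢ Ici (0 : ℝ)) :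
    fderivWithin ℝ (fun q => fderivWithin ℝ g (Ioi 0 ×ˢ Ici 0) q d) (Ioi 0 ×ˢ Ici 0) p e =
      fderivWithin ℝ (fun q => fderivWithin ℝ g (Ioi 0 ×ˢ Ici 0) q e) (Ioi 0 ×ˢ Ici 0) p d := by
  set S := Ioi (0 : ℝ) ×ˢ Ici (0 : ℝ) with hS
  have hu : UniqueDiffOn ℝ S := uniqueDiffOn_Ioi_prod_Ici
  have hd : DifferentiableWithinAt ℝ (fderivWithin ℝ g S) S p :=
    ((hg.fderivWithin hu (m := (⊤ : ℕ∞)) (by simp)).differentiableOn (by simp)) p hp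
  have key : ∀ a b : ℝ × ℝ, fderivWithin ℝ (fun q => fderivWithin ℝ g S q a) S p b =
      fderivWithin ℝ (fderivWithin ℝ g S) S p b a := by
    intro a b
    rw [fderivWithin_clm_apply (hu p hp) hd (differentiableWithinAt_const a)]
    simp
  rw [key, key]
  refine ContDiffWithinAt.isSymmSndFDerivWithinAt (hg p hp) ?_ hu ?_ hp e d
  · rw [minSmoothness_of_isRCLikeNormedField]
    exact WithTop.coe_le_coe.2 le_top
  · rw [hS, interior_prod_eq, interior_Ioi, interior_Ici, closure_prod_eq, closure_Ioi]
    exact ⟨Ioi_subset_Ici_self hp.1, hp.2⟩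

lemma IsSWSolution.exists_regularity {μ ν : ℝ} {f : ℝ → ℝ} {u : ℝ → ℝ → ℝ}
    (hu : IsSWSolution μ ν f u) :
    ∃ v₁ v₂ : ℝ → ℝ → ℝ,
      (∀ s > 0, ∀ y ≥ 0, HasDerivWithinAt (u s) (ux u s y) (Ici 0) y) ∧
      (∀ s > 0, ∀ y ≥ 0, HasDerivWithinAt (ux u s) (v₁ s y) (Ici 0) y) ∧
      (∀ s > 0, ∀ y ≥ 0, HasDerivWithinAt (v₁ s) (v₂ s y) (Ici 0) y) ∧
      (∀ s > 0, ∀ y ≥ 0, HasDerivAt (fun r => ux u r y) (μ * v₁ s y + 1 / 2 * v₂ s y) s) ∧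
      ContinuousOn (fun p : ℝ × ℝ => ux u p.1 p.2) (Ioi 0 ×ˢ Ici 0) ∧
      ContinuousOn (fun p : ℝ × ℝ => v₁ p.1 p.2) (Ioi 0 ×ˢ Ici 0) ∧
      ContinuousOn (fun p : ℝ × ℝ => v₂ p.1 p.2) (Ioi 0 ×ˢ Ici 0) ∧
      ∀ s > 0, v₁ s 0 = 2 * (ν - μ) * ux u s 0 := by
  obtain ⟨hsm, -, -, hpde, -, hbd⟩ := hu
  set U : ℝ × ℝ → ℝ := fun p => u p.1 p.2
  set S := Ioi (0 : ℝ) ×ˢ Ici (0 : ℝ) with hS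
  have hne : ((⊤ : ℕ∞) : WithTop ℕ∞) ≠ 0 := by simp
  set V : ℝ × ℝ → ℝ := fun p => fderivWithin ℝ U S p (0, 1)
  set V₁ : ℝ × ℝ → ℝ := fun p => fderivWithin ℝ V S p (0, 1)
  set V₂ : ℝ × ℝ → ℝ := fun p => fderivWithin ℝ V₁ S p (0, 1)
  set Ut : ℝ × ℝ → ℝ := fun p => fderivWithin ℝ U S p (1, 0)
  have cV : ContDiffOn ℝ (⊤ : ℕ∞) V S := contDiffOn_fderivWithin_const_apply hsm _
  have cV₁ : ContDiffOn ℝ (⊤ : ℕ∞) V₁ S := contDiffOn_fderivWithin_const_apply cV _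
  have cV₂ : ContDiffOn ℝ (⊤ : ℕ∞) V₂ S := contDiffOn_fderivWithin_const_apply cV₁ _
  have dU : ∀ s > 0, ∀ y ≥ 0, HasDerivWithinAt (u s) (V (s, y)) (Ici 0) y := fun s hs y hy =>
    hasDerivWithinAt_snd_of_differentiableOn (hsm.differentiableOn hne) hs hy
  have eV : ∀ s > 0, ∀ y ≥ 0, ux u s y = V (s, y) := fun s hs y hy =>
    (dU s hs y hy).derivWithin (uniqueDiffOn_Ici 0 y hy)
  have dV : ∀ s > 0, ∀ y ≥ 0, HasDerivWithinAt (ux u s) (V₁ (s, y)) (Ici 0) y := fun s hs y hy =>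
    (hasDerivWithinAt_snd_of_differentiableOn (cV.differentiableOn hne) hs hy).congr
      (fun z hz => eV s hs z hz) (eV s hs y hy)
  have eV₁ : ∀ s > 0, ∀ y ≥ 0, uxx u s y = V₁ (s, y) := fun s hs y hy =>
    (dV s hs y hy).derivWithin (uniqueDiffOn_Ici 0 y hy)
  have eUt : ∀ s > 0, ∀ y ≥ 0, ut u s y = Ut (s, y) := fun s hs y hy =>
    (hasDerivAt_fst_of_differentiableOn (hsm.differentiableOn hne) hs hy).deriv
  have pde : ∀ p ∈ S, Ut p = μ * V p + 1 / 2 * V₁ p := by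
    rintro ⟨s, y⟩ ⟨hs, hy⟩
    rw [← eUt s hs y hy, ← eV s hs y hy, ← eV₁ s hs y hy]
    exact hpde s hs y hy
  have time : ∀ s > 0, ∀ y ≥ 0, HasDerivAt (fun r => ux u r y)
      (μ * V₁ (s, y) + 1 / 2 * V₂ (s, y)) s := by
    intro s hs y hy
    have hp : (s, y) ∈ S := ⟨hs, hy⟩
    have h1 := hasDerivAt_fst_of_differentiableOn (cV.differentiableOn hne) hs hy
    have h2 : fderivWithin ℝ V S (s, y) (1, 0) = μ * V₁ (s, y) + 1 / 2 * V₂ (s, y) := by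
      have h3 := fderivWithin_fderivWithin_apply_comm hsm (0, 1) (1, 0) hp
      refine h3.trans ?_
      have h4 : HasFDerivWithinAt (fun p => μ * V p + 1 / 2 * V₁ p)
          (μ • fderivWithin ℝ V S (s, y) + (1 / 2 : ℝ) • fderivWithin ℝ V₁ S (s, y)) S (s, y) :=
        ((cV.differentiableOn hne _ hp).hasFDerivWithinAt.const_mul μ).add
          ((cV₁.differentiableOn hne _ hp).hasFDerivWithinAt.const_mul (1 / 2))
      have h5 := (h4.congr pde (pde _ hp)).fderivWithin (uniqueDiffOn_Ioi_prod_Ici _ hp)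
      change fderivWithin ℝ Ut S (s, y) (0, 1) = _
      rw [h5]
      simp [V₁, V₂]
    rw [h2] at h1
    refine h1.congr_of_eventuallyEq ?_
    filter_upwards [Ioi_mem_nhds hs] with r hr using eV r hr y hy
  refine ⟨fun s y => V₁ (s, y), fun s y => V₂ (s, y), ?_, dV, ?_, time, ?_, ?_, ?_, ?_⟩
  · intro s hs y hy
    rw [eV s hs y hy]
    exact dU s hs y hy
  · exact fun s hs y hy =>
      hasDerivWithinAt_snd_of_differentiableOn (cV₁.differentiableOn hne) hs hy
  · exact cV.continuousOn.congr fun p hp => eV p.1 hp.1 p.2 hp.2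
  · exact cV₁.continuousOn
  · exact cV₂.continuousOn
  · intro s hs
    have h1 := hbd s hs
    have h2 := hpde s hs 0 le_rfl
    rw [eV₁ s hs 0 le_rfl] at h2
    change V₁ (s, 0) = _
    linarith

theorem IsSWSolution.ux_eq_integral {μ ν : ℝ} {f : ℝ → ℝ} {u : ℝ → ℝ → ℝ}
    (hu : IsSWSolution μ ν f u) {t x : ℝ} (ht : 0 < t) (hx : 0 < x) :
    ux u t x = Real.exp (-(μ * x + μ ^ 2 * t / 2)) *
      ∫ y in Ioi 0, Real.exp (μ * y) * derivWithin f (Ici 0) y * robinKer (2 * ν - μ) x t y := by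
  obtain ⟨v₁, v₂, -, dV, dV₁, dt, cV, cV₁, cV₂, hrob⟩ := hu.exists_regularity
  obtain ⟨-, hT, -, -, h0, -⟩ := hu
  obtain ⟨-, hcont, C, hC⟩ := hT t ht
  set e : ℝ → ℝ → ℝ := fun s y => Real.exp (μ * y + μ ^ 2 * s / 2) with he
  have ex : ∀ s y, HasDerivAt (e s) (μ * e s y) y := by
    intro s y
    have h1 : HasDerivAt (fun y => μ * y + μ ^ 2 * s / 2) μ y := by
      simpa using ((hasDerivAt_id y).const_mul μ).add_const (μ ^ 2 * s / 2)
    simpa [he, mul_comm] using h1.exp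
  have et : ∀ s y, HasDerivAt (fun r => e r y) (μ ^ 2 / 2 * e s y) s := by
    intro s y
    have h1 : HasDerivAt (fun s => μ * y + μ ^ 2 * s / 2) (μ ^ 2 / 2) s := by
      simpa using (((hasDerivAt_id s).const_mul (μ ^ 2)).div_const 2).const_add (μ * y)
    simpa [he, mul_comm] using h1.exp
  have ec : Continuous fun p : ℝ × ℝ => e p.1 p.2 := by fun_prop
  have key : IsRobinSolution (2 * ν - μ) t (|C| * Real.exp (μ ^ 2 * t / 2)) |μ|
      (fun s y => e s y * ux u s y) (fun s y => e s y * (μ * ux u s y + v₁ s y))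
      (fun s y => e s y * (μ ^ 2 * ux u s y + 2 * μ * v₁ s y + v₂ s y)) := by
    refine ⟨?_, ?_, ?_, ?_, ?_, ?_, ?_⟩
    · intro s hs y hy
      refine ((ex s y).hasDerivWithinAt.mul (dV s hs y hy)).congr_deriv ?_
      ring
    · intro s hs y hy
      refine ((ex s y).hasDerivWithinAt.mul
        (((dV s hs y hy).const_mul μ).add (dV₁ s hs y hy))).congr_deriv ?_
      simp only [Pi.add_apply]
      ring
    · intro s hs y hy
      refine ((et s y).mul (dt s hs y hy)).congr_deriv ?_
      ring
    · exact ec.continuousOn.mul hcont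
    · exact ec.continuousOn.mul (((cV.const_mul _).add (cV₁.const_mul _)).add cV₂)
    · intro s hs y hy
      rw [abs_mul, abs_of_pos (Real.exp_pos _), mul_comm, mul_assoc, ← Real.exp_add]
      refine mul_le_mul (((hC (s, y) ⟨hs, hy⟩).2).trans (le_abs_self C))
        (Real.exp_le_exp.2 ?_) (Real.exp_pos _).le (abs_nonneg C)
      have h1 := mul_le_mul_of_nonneg_right (le_abs_self μ) hy
      have h2 := mul_le_mul_of_nonneg_left hs.2 (sq_nonneg μ)
      linarith
    · intro s hs
      simp only [hrob s hs]
      ring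
  have h1 := key.eq_integral ht hx
  have h2 : ∀ y ∈ Ioi (0 : ℝ), e 0 y * ux u 0 y * robinKer (2 * ν - μ) x t y =
      Real.exp (μ * y) * derivWithin f (Ici 0) y * robinKer (2 * ν - μ) x t y := by
    intro y hy
    have h3 : ux u 0 y = derivWithin f (Ici 0) y :=
      derivWithin_congr (fun z hz => h0 z hz) (h0 y (le_of_lt hy))
    simp [he, h3]
  rw [setIntegral_congr_fun measurableSet_Ioi h2] at h1
  rw [← h1, ← mul_assoc, ← Real.exp_add]
  simp

/-! ### The kernel of the probabilistic representation -/

/-- The density of the pair `(s - b, s)` for `(b, s)` distributed according to `gker`. -/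
noncomputable def jointDensity (μ t s y : ℝ) : ℝ :=
  2 * ((s + y) / t) * heatKer t (s + y) * Real.exp (-μ * (s - y) - μ ^ 2 * t / 2)

lemma gker_eq_jointDensity (μ : ℝ) {t s y : ℝ} (ht : 0 < t) (hs : 0 ≤ s) (hy : 0 ≤ y) :
    gker μ t (s - y) s = jointDensity μ t s y := by
  have h1 : t ^ (-(3 : ℝ) / 2) = (t * Real.sqrt t)⁻¹ := by
    rw [neg_div, Real.rpow_neg ht.le, Real.sqrt_eq_rpow]
    congr 1
    nth_rewrite 2 [← Real.rpow_one t]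
    rw [← Real.rpow_add ht]
    norm_num
  have h2 : Real.sqrt (2 / Real.pi) = 2 / Real.sqrt (2 * Real.pi) := by
    rw [Real.sqrt_div zero_le_two, Real.sqrt_mul zero_le_two]
    have := Real.sqrt_pos.2 Real.pi_pos
    have h3 : Real.sqrt 2 * Real.sqrt 2 = 2 := Real.mul_self_sqrt zero_le_two
    have := Real.sqrt_pos.2 (zero_lt_two (α := ℝ))
    field_simp
    linarith
  have h3 : -(2 * s - (s - y)) ^ 2 / (2 * t) - μ * (s - y + μ * t / 2) =
      -((s + y) / Real.sqrt t) ^ 2 / 2 + (-μ * (s - y) - μ ^ 2 * t / 2) := by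
    rw [div_pow, Real.sq_sqrt ht.le]
    field_simp
    ring
  unfold gker jointDensity heatKer phi
  rw [if_pos ⟨by linarith, hs⟩, h1, h2, h3, Real.exp_add]
  have := Real.sqrt_pos.2 ht
  have h4 : 0 < Real.sqrt (2 * Real.pi) := Real.sqrt_pos.2 (by positivity)
  field_simp
  ring

lemma jointDensity_nonneg (μ : ℝ) {t s y : ℝ} (ht : 0 < t) (hs : 0 ≤ s) (hy : 0 ≤ y) :
    0 ≤ jointDensity μ t s y :=
  mul_nonneg (mul_nonneg (by positivity) (heatKer_nonneg _ _)) (Real.exp_pos _).le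

lemma continuous_jointDensity (μ : ℝ) {t : ℝ} (ht : 0 < t) :
    Continuous fun p : ℝ × ℝ => jointDensity μ t p.1 p.2 := by
  have := (continuous_heatKer ht).comp (continuous_fst.add continuous_snd : Continuous
    fun p : ℝ × ℝ => p.1 + p.2)
  unfold jointDensity
  refine Continuous.mul (Continuous.mul (by fun_prop) this) (by fun_prop)

lemma exists_jointDensity_bound (μ : ℝ) {t Λ : ℝ} (ht : 0 < t) (hΛ : 0 ≤ Λ) :
    ∃ K, 0 ≤ K ∧ ∀ s ≥ 0, ∀ y ≥ 0,
      Real.exp (Λ * s) * jointDensity μ t s y ≤ K * (Real.exp (-s) * Real.exp (-y)) := by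
  obtain ⟨K, hK0, hK⟩ := exists_kernel_bound 0 ht t (B := 2 + |μ| + Λ)
    (by rw [neg_zero]; positivity)
  refine ⟨2 / t * K * Real.exp (|μ| ^ 2 * t / 2), by positivity, fun s hs y hy => ?_⟩
  have h1 := (hK t ⟨le_rfl, le_rfl⟩ (s + y)).1
  have h2 : s + y ≤ Real.exp (s + y) := by linarith [Real.add_one_le_exp (s + y)]
  have h3 : 2 * ((s + y) / t) ≤ 2 / t * Real.exp (s + y) := by
    rw [mul_div_assoc', mul_comm 2 (s + y), mul_div_assoc, mul_comm]
    gcongr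
  have h4 : -μ * (s - y) - μ ^ 2 * t / 2 ≤ |μ| * (s + y) := by
    have e1 : -μ * (s - y) ≤ |μ| * s + |μ| * y := by
      have a1 := mul_le_mul_of_nonneg_right (neg_abs_le μ) hs
      have a2 := mul_le_mul_of_nonneg_right (le_abs_self μ) hy
      linarith
    have e2 : 0 ≤ μ ^ 2 * t := by positivity
    linarith
  have h5 : Λ * s ≤ Λ * (s + y) := by
    have := mul_nonneg hΛ hy
    linarith
  calc Real.exp (Λ * s) * jointDensity μ t s y
      ≤ Real.exp (Λ * (s + y)) * (2 / t * Real.exp (s + y) *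
          (K * Real.exp (-(2 + |μ| + Λ) * (s + y))) * Real.exp (|μ| * (s + y))) := by
        unfold jointDensity
        have := heatKer_nonneg t (s + y)
        gcongr
    _ = 2 / t * K * (Real.exp (Λ * (s + y)) * Real.exp (s + y) *
          Real.exp (-(2 + |μ| + Λ) * (s + y)) * Real.exp (|μ| * (s + y))) := by ring
    _ = 2 / t * K * 1 * (Real.exp (-s) * Real.exp (-y)) := by
        simp only [← Real.exp_add, mul_one]
        congr 2
        ring
    _ ≤ _ := by
        gcongr
        exact Real.one_le_exp (by positivity)

lemma tendsto_exp_mul_kernels (κ c : ℝ) {t : ℝ} (ht : 0 < t) :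
    Tendsto (fun s => Real.exp (-κ * s) * (heatKer t (s + c) - κ * tailKer κ t (s + c)))
      atTop (nhds 0) := by
  set B := |κ| + 1
  have hB : -κ ≤ B := by
    simp only [B]
    linarith [neg_le_abs κ]
  obtain ⟨K, hK0, hK⟩ := exists_kernel_bound κ ht t hB
  have hlim : Tendsto (fun s : ℝ => (1 + |κ|) * (K * Real.exp (-B * c)) * Real.exp (-s)) atTop
      (nhds 0) := by
    simpa using (Real.tendsto_exp_neg_atTop_nhds_zero).const_mul
      ((1 + |κ|) * (K * Real.exp (-B * c)))
  refine squeeze_zero_norm' ?_ hlim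
  filter_upwards [eventually_ge_atTop 0] with s hs
  have h1 := (hK t ⟨le_rfl, le_rfl⟩ (s + c)).1
  have h2 := (hK t ⟨le_rfl, le_rfl⟩ (s + c)).2.2
  rw [norm_mul, Real.norm_of_nonneg (Real.exp_pos _).le]
  have h3 : ‖heatKer t (s + c) - κ * tailKer κ t (s + c)‖ ≤
      (1 + |κ|) * (K * Real.exp (-B * (s + c))) := by
    refine (norm_sub_le _ _).trans ?_
    rw [norm_mul, Real.norm_of_nonneg (heatKer_nonneg _ _),
      Real.norm_of_nonneg (tailKer_nonneg _ _ _), Real.norm_eq_abs, add_mul, one_mul]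
    gcongr
  have h4 : Real.exp (-κ * s) * Real.exp (-B * (s + c)) ≤ Real.exp (-B * c) * Real.exp (-s) := by
    rw [← Real.exp_add, ← Real.exp_add]
    apply Real.exp_le_exp.2
    have := mul_le_mul_of_nonneg_right (neg_le_abs κ) hs
    simp only [B]
    linarith
  calc _ ≤ Real.exp (-κ * s) * ((1 + |κ|) * (K * Real.exp (-B * (s + c)))) := by gcongr
    _ = (1 + |κ|) * K * (Real.exp (-κ * s) * Real.exp (-B * (s + c))) := by ring
    _ ≤ (1 + |κ|) * K * (Real.exp (-B * c) * Real.exp (-s)) := by gcongr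
    _ = _ := by ring

lemma integral_Ioi_exp_mul_heatKer (κ : ℝ) {t x y : ℝ} (ht : 0 < t) (hx : 0 ≤ x) (hy : 0 ≤ y) :
    ∫ s in Ioi x, Real.exp (-κ * (s - x)) * (2 * ((s + y) / t) * heatKer t (s + y)) =
      2 * heatKer t (x + y) - 2 * κ * tailKer κ t (x + y) := by
  have hd : ∀ s ∈ Ici x, HasDerivAt
      (fun s => -2 * Real.exp (κ * x) * (Real.exp (-κ * s) *
        (heatKer t (s + y) - κ * tailKer κ t (s + y))))
      (Real.exp (-κ * (s - x)) * (2 * ((s + y) / t) * heatKer t (s + y))) s := by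
    intro s _
    have h1 : HasDerivAt (fun s => Real.exp (-κ * s)) (Real.exp (-κ * s) * -κ) s := by
      simpa using ((hasDerivAt_id s).const_mul (-κ)).exp
    have h2 := (hasDerivAt_heatKer ht (s + y)).comp_add_const s y
    have h3 := (hasDerivAt_tailKer κ ht (s + y)).comp_add_const s y
    refine ((h1.mul (h2.sub (h3.const_mul κ))).const_mul (-2 * Real.exp (κ * x))).congr_deriv ?_
    rw [show -κ * (s - x) = κ * x + -κ * s by ring, Real.exp_add]
    simp only [Pi.sub_apply]
    ring
  have hl := (tendsto_exp_mul_kernels κ y ht).const_mul (-2 * Real.exp (κ * x))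
  rw [mul_zero] at hl
  rw [integral_Ioi_of_hasDerivAt_of_nonneg' hd ?_ hl]
  · rw [neg_mul κ x, Real.exp_neg]
    have := Real.exp_pos (κ * x)
    field_simp
    ring
  · intro s hs
    have h1 : 0 ≤ s := hx.trans (le_of_lt hs)
    have := heatKer_nonneg t (s + y)
    positivity

lemma integral_two_mul_heatKer {t : ℝ} (ht : 0 < t) (a b c : ℝ) :
    ∫ s in a..b, 2 * ((2 * s + c) / t) * heatKer t (2 * s + c) =
      heatKer t (2 * a + c) - heatKer t (2 * b + c) := by
  have hd : ∀ s ∈ uIcc a b, HasDerivAt (fun s => -heatKer t (2 * s + c))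
      (2 * ((2 * s + c) / t) * heatKer t (2 * s + c)) s := by
    intro s _
    have h1 : HasDerivAt (fun s : ℝ => 2 * s + c) 2 s := by
      simpa using ((hasDerivAt_id s).const_mul 2).add_const c
    refine ((hasDerivAt_heatKer ht (2 * s + c)).comp s h1).neg.congr_deriv ?_
    ring
  have hc : Continuous fun s => 2 * ((2 * s + c) / t) * heatKer t (2 * s + c) :=
    Continuous.mul (by fun_prop) ((continuous_heatKer ht).comp (by fun_prop))
  rw [intervalIntegral.integral_eq_sub_of_hasDerivAt hd (hc.intervalIntegrable _ _)]
  ring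

/-! ### The probabilistic representation as a function of `x` -/

/-- The integrand of the probabilistic representation, in the coordinate `y = s - b`. -/
noncomputable def payoff (F F' : ℝ → ℝ) (lam x s y : ℝ) : ℝ :=
  F (y + max (x - s) 0) - F' y * ∫ r in (0 : ℝ)..max (s - x) 0, Real.exp (-lam * r)

/-- The `x`-derivative of `payoff`. -/
noncomputable def payoffSlope (F' : ℝ → ℝ) (lam x s y : ℝ) : ℝ :=
  F' (y + max (x - s) 0) * Real.exp (-lam * max (s - x) 0)

lemma payoff_eq_add_integral {F F' : ℝ → ℝ} (hF : ∀ y, HasDerivAt F (F' y) y)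
    (hF' : Continuous F') (lam x s y : ℝ) :
    payoff F F' lam x s y =
      F y + ∫ d in (0 : ℝ)..(x - s), payoffSlope F' lam d 0 y := by
  unfold payoff payoffSlope
  rcases le_total 0 (x - s) with h | h
  · have h1 : s - x ≤ 0 := by linarith
    rw [max_eq_left h, max_eq_right h1, intervalIntegral.integral_same]
    have h2 : ∫ d in (0 : ℝ)..(x - s), F' (y + max (d - 0) 0) * Real.exp (-lam * max (0 - d) 0) =
        ∫ d in (0 : ℝ)..(x - s), F' (y + d) := by
      refine intervalIntegral.integral_congr fun d hd => ?_
      rw [uIcc_of_le h] at hd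
      have h3 : 0 - d ≤ 0 := by linarith [hd.1]
      simp only [sub_zero, max_eq_left hd.1, max_eq_right h3, mul_zero, Real.exp_zero, mul_one]
    rw [h2, intervalIntegral.integral_eq_sub_of_hasDerivAt
      (f := fun d => F (y + d)) (fun d _ => (hF (y + d)).comp_const_add y d)
      ((hF'.comp (continuous_const_add y)).intervalIntegrable _ _)]
    simp
  · have h1 : 0 ≤ s - x := by linarith
    rw [max_eq_right h, max_eq_left h1]
    have h2 : ∫ d in (0 : ℝ)..(x - s), F' (y + max (d - 0) 0) * Real.exp (-lam * max (0 - d) 0) =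
        ∫ d in (0 : ℝ)..(x - s), F' y * Real.exp (-lam * -d) := by
      refine intervalIntegral.integral_congr fun d hd => ?_
      rw [uIcc_of_ge h] at hd
      have h3 : 0 ≤ -d := by linarith [hd.2]
      simp only [sub_zero, max_eq_right hd.2, zero_sub, max_eq_left h3, add_zero]
    rw [h2, intervalIntegral.integral_const_mul,
      intervalIntegral.integral_comp_neg fun r => Real.exp (-lam * r), neg_zero, neg_sub,
      intervalIntegral.integral_symm]
    rw [add_zero]
    ring

lemma continuous_payoffSlope {F' : ℝ → ℝ} (hF' : Continuous F') (lam x : ℝ) :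
    Continuous fun p : ℝ × ℝ => payoffSlope F' lam x p.1 p.2 := by
  unfold payoffSlope
  exact (hF'.comp (by fun_prop)).mul (by fun_prop)

lemma continuous_payoff {F F' : ℝ → ℝ} (hF : Continuous F) (hF' : Continuous F') (lam x : ℝ) :
    Continuous fun p : ℝ × ℝ => payoff F F' lam x p.1 p.2 := by
  have h1 : Continuous fun a : ℝ => ∫ r in (0 : ℝ)..a, Real.exp (-lam * r) :=
    intervalIntegral.continuous_primitive
      (fun a b => (by fun_prop : Continuous fun r => Real.exp (-lam * r)).intervalIntegrable a b) 0
  unfold payoff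
  exact (hF.comp (by fun_prop)).sub ((hF'.comp continuous_snd).mul (h1.comp (by fun_prop)))

lemma hasDerivAt_payoff {F F' : ℝ → ℝ} (hF : ∀ y, HasDerivAt F (F' y) y)
    (hF' : Continuous F') (lam x s y : ℝ) :
    HasDerivAt (fun x => payoff F F' lam x s y) (payoffSlope F' lam x s y) x := by
  have hc : Continuous fun d => payoffSlope F' lam d 0 y := by
    unfold payoffSlope
    exact (hF'.comp (by fun_prop)).mul (by fun_prop)
  have h1 := (hc.integral_hasStrictDerivAt 0 (x - s)).hasDerivAt.comp_sub_const x s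
  have h2 : payoffSlope F' lam (x - s) 0 y = payoffSlope F' lam x s y := by
    simp [payoffSlope]
  rw [h2] at h1
  simp_rw [payoff_eq_add_integral hF hF']
  exact h1.const_add _

lemma abs_payoffSlope_le {F' : ℝ → ℝ} {C : ℝ} (hC : ∀ y ≥ 0, |F' y| ≤ C) (lam x : ℝ) {s y : ℝ}
    (hs : 0 ≤ s) (hy : 0 ≤ y) :
    |payoffSlope F' lam x s y| ≤ C * Real.exp (|lam| * |x|) * Real.exp (|lam| * s) := by
  have h1 := hC (y + max (x - s) 0) (add_nonneg hy (le_max_right _ _))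
  have hC0 : 0 ≤ C := (abs_nonneg _).trans h1
  unfold payoffSlope
  rw [abs_mul, abs_of_pos (Real.exp_pos _), mul_assoc, ← Real.exp_add]
  refine mul_le_mul h1 (Real.exp_le_exp.2 ?_) (Real.exp_pos _).le hC0
  have h2 : max (s - x) 0 ≤ |x| + s :=
    max_le (by linarith [neg_le_abs x]) (add_nonneg (abs_nonneg x) hs)
  have h3 := mul_le_mul (neg_le_abs lam) h2 (le_max_right _ _) (abs_nonneg lam)
  linarith

lemma abs_payoff_le {F F' : ℝ → ℝ} {C : ℝ} (hC : ∀ y ≥ 0, |F y| ≤ C)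
    (hC' : ∀ y ≥ 0, |F' y| ≤ C) (lam : ℝ) {x s y : ℝ} (hx : 0 ≤ x) (hs : 0 ≤ s) (hy : 0 ≤ y) :
    |payoff F F' lam x s y| ≤ 2 * C * Real.exp ((|lam| + 1) * s) := by
  have h1 := hC (y + max (x - s) 0) (add_nonneg hy (le_max_right _ _))
  have hC0 : 0 ≤ C := (abs_nonneg _).trans h1
  have hl0 : 0 ≤ max (s - x) 0 := le_max_right _ _
  have hls : max (s - x) 0 ≤ s := max_le (by linarith) hs
  have h2 : |∫ r in (0 : ℝ)..max (s - x) 0, Real.exp (-lam * r)| ≤ Real.exp ((|lam| + 1) * s) := by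
    have h3 := intervalIntegral.norm_integral_le_of_norm_le_const
      (a := 0) (b := max (s - x) 0) (f := fun r => Real.exp (-lam * r)) (C := Real.exp (|lam| * s))
      (by
        intro r hr
        rw [uIoc_of_le hl0] at hr
        rw [Real.norm_of_nonneg (Real.exp_pos _).le]
        apply Real.exp_le_exp.2
        exact mul_le_mul (neg_le_abs lam) (hr.2.trans hls) hr.1.le (abs_nonneg lam))
    rw [sub_zero, abs_of_nonneg hl0, Real.norm_eq_abs] at h3
    refine h3.trans ?_
    rw [add_mul, one_mul, Real.exp_add]
    gcongr
    linarith [Real.add_one_le_exp s]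
  have h4 : 1 ≤ Real.exp ((|lam| + 1) * s) := Real.one_le_exp (by positivity)
  unfold payoff
  refine (abs_sub _ _).trans ?_
  rw [abs_mul]
  have h5 := mul_le_mul (hC' y hy) h2 (abs_nonneg _) hC0
  have h6 := mul_le_mul_of_nonneg_left h4 hC0
  linarith

/-- Lebesgue measure on the open quarter plane. -/
noncomputable def quarterMeasure : Measure (ℝ × ℝ) :=
  (volume.restrict (Ioi (0 : ℝ))).prod (volume.restrict (Ioi (0 : ℝ)))

lemma ae_quarterMeasure : ∀ᵐ p ∂quarterMeasure, 0 < p.1 ∧ 0 < p.2 := by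
  unfold quarterMeasure
  rw [Measure.prod_restrict]
  filter_upwards [ae_restrict_mem (measurableSet_Ioi.prod measurableSet_Ioi)] with p hp using hp

lemma integrable_exp_neg_quarterMeasure :
    Integrable (fun p : ℝ × ℝ => Real.exp (-p.1) * Real.exp (-p.2)) quarterMeasure :=
  Integrable.mul_prod integrableOn_Ioi_zero_exp_neg integrableOn_Ioi_zero_exp_neg

lemma integrable_quarterMeasure {h : ℝ × ℝ → ℝ} {K : ℝ}
    (hm : AEStronglyMeasurable h quarterMeasure)
    (hK : ∀ s > 0, ∀ y > 0, |h (s, y)| ≤ K * (Real.exp (-s) * Real.exp (-y))) :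
    Integrable h quarterMeasure := by
  refine (integrable_exp_neg_quarterMeasure.const_mul K).mono' hm ?_
  filter_upwards [ae_quarterMeasure] with p hp using hK p.1 hp.1 p.2 hp.2

lemma abs_mul_jointDensity_le {μ t Λ K C k s y : ℝ} (ht : 0 < t)
    (hK : ∀ s ≥ 0, ∀ y ≥ 0,
      Real.exp (Λ * s) * jointDensity μ t s y ≤ K * (Real.exp (-s) * Real.exp (-y)))
    (hC : 0 ≤ C) (hs : 0 ≤ s) (hy : 0 ≤ y) (hk : |k| ≤ C * Real.exp (Λ * s)) :
    |k * jointDensity μ t s y| ≤ C * K * (Real.exp (-s) * Real.exp (-y)) := by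
  have h0 := jointDensity_nonneg μ ht hs hy
  rw [abs_mul, abs_of_nonneg h0]
  calc |k| * jointDensity μ t s y ≤ C * Real.exp (Λ * s) * jointDensity μ t s y := by gcongr
    _ = C * (Real.exp (Λ * s) * jointDensity μ t s y) := by ring
    _ ≤ C * (K * (Real.exp (-s) * Real.exp (-y))) :=
      mul_le_mul_of_nonneg_left (hK s hs y hy) hC
    _ = _ := by ring

lemma integrable_payoff_mul_jointDensity {F F' : ℝ → ℝ} (hF : ∀ y, HasDerivAt F (F' y) y)
    (hF' : Continuous F') {C : ℝ} (hC : ∀ y ≥ 0, |F y| ≤ C) (hC' : ∀ y ≥ 0, |F' y| ≤ C)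
    (μ lam : ℝ) {t x : ℝ} (ht : 0 < t) (hx : 0 ≤ x) :
    Integrable (fun p : ℝ × ℝ => payoff F F' lam x p.1 p.2 * jointDensity μ t p.1 p.2)
      quarterMeasure := by
  have hFc : Continuous F := continuous_iff_continuousAt.2 fun y => (hF y).continuousAt
  have hC0 : 0 ≤ C := (abs_nonneg _).trans (hC 0 le_rfl)
  obtain ⟨K, -, hK⟩ := exists_jointDensity_bound μ ht (Λ := |lam| + 1) (by positivity)
  refine integrable_quarterMeasure
    ((continuous_payoff hFc hF' lam x).mul (continuous_jointDensity μ ht)).aestronglyMeasurable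
    (K := 2 * C * K) fun s hs y hy => ?_
  exact abs_mul_jointDensity_le ht hK (by positivity) hs.le hy.le
    (abs_payoff_le hC hC' lam hx hs.le hy.le)

lemma hasDerivAt_integral_payoff {F F' : ℝ → ℝ} (hF : ∀ y, HasDerivAt F (F' y) y)
    (hF' : Continuous F') {C : ℝ} (hC : ∀ y ≥ 0, |F y| ≤ C) (hC' : ∀ y ≥ 0, |F' y| ≤ C)
    (μ lam : ℝ) {t x : ℝ} (ht : 0 < t) (hx : 0 ≤ x) :
    HasDerivAt
      (fun x => ∫ p, payoff F F' lam x p.1 p.2 * jointDensity μ t p.1 p.2 ∂quarterMeasure)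
      (∫ p, payoffSlope F' lam x p.1 p.2 * jointDensity μ t p.1 p.2 ∂quarterMeasure) x := by
  have hFc : Continuous F := continuous_iff_continuousAt.2 fun y => (hF y).continuousAt
  have hC0 : 0 ≤ C := (abs_nonneg _).trans (hC 0 le_rfl)
  have hd := continuous_jointDensity μ ht
  obtain ⟨K, -, hK⟩ := exists_jointDensity_bound μ ht (abs_nonneg lam)
  refine (hasDerivAt_integral_of_dominated_loc_of_deriv_le
    (F := fun x (p : ℝ × ℝ) => payoff F F' lam x p.1 p.2 * jointDensity μ t p.1 p.2)
    (F' := fun x (p : ℝ × ℝ) => payoffSlope F' lam x p.1 p.2 * jointDensity μ t p.1 p.2)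
    (bound := fun p : ℝ × ℝ =>
      C * Real.exp (|lam| * (|x| + 1)) * K * (Real.exp (-p.1) * Real.exp (-p.2)))
    (Metric.ball_mem_nhds x one_pos) ?_ ?_ ?_ ?_ ?_ ?_).2
  · exact Eventually.of_forall fun z =>
      ((continuous_payoff hFc hF' lam z).mul hd).aestronglyMeasurable
  · exact integrable_payoff_mul_jointDensity hF hF' hC hC' μ lam ht hx
  · exact ((continuous_payoffSlope hF' lam x).mul hd).aestronglyMeasurable
  · filter_upwards [ae_quarterMeasure] with p hp z hz
    refine abs_mul_jointDensity_le ht hK (by positivity) hp.1.le hp.2.le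
      ((abs_payoffSlope_le hC' lam z hp.1.le hp.2.le).trans ?_)
    have h1 : |z| ≤ |x| + 1 := by
      rw [Metric.mem_ball, Real.dist_eq] at hz
      have := abs_sub_abs_le_abs_sub z x
      linarith
    gcongr
  · exact integrable_exp_neg_quarterMeasure.const_mul _
  · exact Eventually.of_forall fun p z _ => (hasDerivAt_payoff hF hF' lam z p.1 p.2).mul_const _

lemma tendsto_integral_payoff {F F' : ℝ → ℝ} (hF : ∀ y, HasDerivAt F (F' y) y)
    (hF' : Continuous F') {C : ℝ} (hC : ∀ y ≥ 0, |F y| ≤ C) (hC' : ∀ y ≥ 0, |F' y| ≤ C)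
    (hlim : Tendsto F atTop (nhds 0)) (μ lam : ℝ) {t : ℝ} (ht : 0 < t) :
    Tendsto
      (fun x => ∫ p, payoff F F' lam x p.1 p.2 * jointDensity μ t p.1 p.2 ∂quarterMeasure)
      atTop (nhds 0) := by
  have hFc : Continuous F := continuous_iff_continuousAt.2 fun y => (hF y).continuousAt
  have hC0 : 0 ≤ C := (abs_nonneg _).trans (hC 0 le_rfl)
  obtain ⟨K, -, hK⟩ := exists_jointDensity_bound μ ht (Λ := |lam| + 1) (by positivity)
  rw [show nhds (0 : ℝ) = nhds (∫ _, (0 : ℝ) ∂quarterMeasure) by simp]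
  refine tendsto_integral_filter_of_dominated_convergence
    (fun p => 2 * C * K * (Real.exp (-p.1) * Real.exp (-p.2))) ?_ ?_
    (integrable_exp_neg_quarterMeasure.const_mul _) ?_
  · exact Eventually.of_forall fun z =>
      ((continuous_payoff hFc hF' lam z).mul (continuous_jointDensity μ ht)).aestronglyMeasurable
  · filter_upwards [eventually_ge_atTop 0] with x hx
    filter_upwards [ae_quarterMeasure] with p hp
    exact abs_mul_jointDensity_le ht hK (by positivity) hp.1.le hp.2.le
      (abs_payoff_le hC hC' lam hx hp.1.le hp.2.le)
  · refine Eventually.of_forall fun p => ?_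
    have h1 : Tendsto (fun x => F (p.2 - p.1 + x)) atTop (nhds 0) :=
      hlim.comp (tendsto_atTop_add_const_left _ _ tendsto_id)
    have h2 := h1.mul_const (jointDensity μ t p.1 p.2)
    rw [zero_mul] at h2
    refine h2.congr' ?_
    filter_upwards [eventually_ge_atTop p.1] with x hx
    unfold payoff
    rw [max_eq_left (sub_nonneg.2 hx), max_eq_right (sub_nonpos.2 hx),
      intervalIntegral.integral_same, mul_zero, sub_zero]
    congr 2
    ring

/-- The joint density of the starting variable and the position reached, before averaging over
the running maximum `s`. -/
noncomputable def shiftedDensity (μ lam t x s y : ℝ) : ℝ :=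
  (Ioi (max (x - s) 0)).indicator
    (fun y => Real.exp (-lam * max (s - x) 0) * jointDensity μ t s (y - max (x - s) 0)) y

lemma measurable_shiftedDensity (μ lam x : ℝ) {t : ℝ} (ht : 0 < t) :
    Measurable fun p : ℝ × ℝ => shiftedDensity μ lam t x p.1 p.2 := by
  have h1 : MeasurableSet {p : ℝ × ℝ | max (x - p.1) 0 < p.2} :=
    measurableSet_lt (by fun_prop) (by fun_prop)
  have h2 : Measurable fun p : ℝ × ℝ =>
      Real.exp (-lam * max (p.1 - x) 0) * jointDensity μ t p.1 (p.2 - max (x - p.1) 0) := by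
    have := (continuous_jointDensity μ ht).comp
      (by fun_prop : Continuous fun p : ℝ × ℝ => (p.1, p.2 - max (x - p.1) 0))
    exact (Continuous.mul (by fun_prop) this).measurable
  exact h2.indicator h1

lemma exists_shiftedDensity_bound (μ lam : ℝ) {t x : ℝ} (ht : 0 < t) (hx : 0 ≤ x) :
    ∃ K, 0 ≤ K ∧ ∀ s > 0, ∀ y > 0,
      |shiftedDensity μ lam t x s y| ≤ K * (Real.exp (-s) * Real.exp (-y)) := by
  obtain ⟨K, hK0, hK⟩ := exists_jointDensity_bound μ ht (abs_nonneg lam)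
  refine ⟨K * Real.exp x, by positivity, fun s hs y hy => ?_⟩
  unfold shiftedDensity
  by_cases h : y ∈ Ioi (max (x - s) 0)
  · rw [indicator_of_mem h]
    have hy' : 0 ≤ y - max (x - s) 0 := sub_nonneg.2 (le_of_lt h)
    have h0 := jointDensity_nonneg μ ht hs.le hy'
    rw [abs_of_nonneg (by positivity)]
    have h1 : -lam * max (s - x) 0 ≤ |lam| * s :=
      mul_le_mul (neg_le_abs lam) (max_le (by linarith) hs.le) (le_max_right _ _) (abs_nonneg lam)
    have h2 : -(y - max (x - s) 0) ≤ x + -y := by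
      have : max (x - s) 0 ≤ x := max_le (by linarith) hx
      linarith
    calc _ ≤ Real.exp (|lam| * s) * jointDensity μ t s (y - max (x - s) 0) := by gcongr
      _ ≤ K * (Real.exp (-s) * Real.exp (-(y - max (x - s) 0))) := hK s hs.le _ hy'
      _ ≤ K * (Real.exp (-s) * Real.exp (x + -y)) := by gcongr
      _ = _ := by
        rw [Real.exp_add]
        ring
  · rw [indicator_of_notMem h, abs_zero]
    positivity

lemma integral_payoffSlope_slice (F' : ℝ → ℝ) (μ lam t x s : ℝ) :
    ∫ y in Ioi 0, payoffSlope F' lam x s y * jointDensity μ t s y =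
      ∫ y in Ioi 0, F' y * shiftedDensity μ lam t x s y := by
  set a := max (x - s) 0 with ha
  have ha0 : 0 ≤ a := le_max_right _ _
  rw [← integral_indicator measurableSet_Ioi, ← integral_indicator measurableSet_Ioi,
    ← integral_sub_right_eq_self _ a]
  congr 1
  ext y
  unfold shiftedDensity payoffSlope
  rw [← ha]
  by_cases h : y ∈ Ioi a
  · have h1 : y - a ∈ Ioi (0 : ℝ) := mem_Ioi.2 (sub_pos.2 (mem_Ioi.1 h))
    have h2 : y ∈ Ioi (0 : ℝ) := ha0.trans_lt h
    rw [indicator_of_mem h1, indicator_of_mem h2, indicator_of_mem h, sub_add_cancel]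
    ring
  · have h1 : y - a ∉ Ioi (0 : ℝ) := fun h1 =>
      h (mem_Ioi.2 (sub_pos.1 (mem_Ioi.1 h1)))
    rw [indicator_of_notMem h1]
    by_cases h2 : y ∈ Ioi (0 : ℝ)
    · rw [indicator_of_mem h2, indicator_of_notMem h, mul_zero]
    · rw [indicator_of_notMem h2]

lemma integral_shiftedDensity (μ lam : ℝ) {t x y : ℝ} (ht : 0 < t) (hx : 0 < x) (hy : 0 < y) :
    ∫ s in Ioi 0, shiftedDensity μ lam t x s y =
      Real.exp (-(μ * x + μ ^ 2 * t / 2)) * (Real.exp (μ * y) * robinKer (lam + μ) x t y) := by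
  set c := Real.exp (-μ * (x - y) - μ ^ 2 * t / 2) with hc
  obtain ⟨K, hK0, hK⟩ := exists_shiftedDensity_bound μ lam ht hx.le
  have hint : IntegrableOn (fun s => shiftedDensity μ lam t x s y) (Ioi 0) := by
    refine ((integrableOn_Ioi_zero_exp_neg.mul_const (Real.exp (-y))).const_mul K).mono'
      ((measurable_shiftedDensity μ lam x ht).comp
        (measurable_id.prodMk measurable_const)).aestronglyMeasurable ?_
    filter_upwards [ae_restrict_mem measurableSet_Ioi] with s hs using hK s hs y hy
  rw [← Ioc_union_Ioi_eq_Ioi hx.le] at hint ⊢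
  rw [setIntegral_union (Ioc_disjoint_Ioi le_rfl) measurableSet_Ioi
    (hint.mono_set subset_union_left) (hint.mono_set subset_union_right)]
  have h1 : ∫ s in Ioi x, shiftedDensity μ lam t x s y =
      c * (2 * heatKer t (x + y) - 2 * (lam + μ) * tailKer (lam + μ) t (x + y)) := by
    rw [← integral_Ioi_exp_mul_heatKer (lam + μ) ht hx.le hy.le, ← integral_const_mul]
    refine setIntegral_congr_fun measurableSet_Ioi fun s hs => ?_
    have hs' : 0 ≤ s - x := sub_nonneg.2 (le_of_lt hs)
    have hs'' : x - s ≤ 0 := sub_nonpos.2 (le_of_lt hs)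
    simp only [shiftedDensity, jointDensity, max_eq_left hs', max_eq_right hs'', sub_zero, hc]
    rw [indicator_of_mem (mem_Ioi.2 hy)]
    have e1 : Real.exp (-lam * (s - x)) * Real.exp (-μ * (s - y) - μ ^ 2 * t / 2) =
        Real.exp (-μ * (x - y) - μ ^ 2 * t / 2) * Real.exp (-(lam + μ) * (s - x)) := by
      rw [← Real.exp_add, ← Real.exp_add]
      congr 1
      ring
    linear_combination (2 * ((s + y) / t) * heatKer t (s + y)) * e1
  have h2 : ∫ s in Ioc 0 x, shiftedDensity μ lam t x s y =
      c * (heatKer t (y - x) - heatKer t (x + y)) := by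
    have e1 : ∫ s in Ioc 0 x, shiftedDensity μ lam t x s y =
        ∫ s in Ioc (max 0 (x - y)) x,
          c * (2 * ((2 * s + (y - x)) / t) * heatKer t (2 * s + (y - x))) := by
      rw [← integral_indicator measurableSet_Ioc, ← integral_indicator measurableSet_Ioc]
      congr 1
      ext s
      by_cases hs : s ∈ Ioc 0 x
      · have hs' : 0 ≤ x - s := sub_nonneg.2 hs.2
        have hs'' : s - x ≤ 0 := sub_nonpos.2 hs.2
        rw [indicator_of_mem hs]
        simp only [shiftedDensity, jointDensity, max_eq_left hs', max_eq_right hs'', mul_zero,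
          Real.exp_zero, one_mul]
        by_cases h : y ∈ Ioi (x - s)
        · have h3 : s ∈ Ioc (max 0 (x - y)) x :=
            ⟨max_lt hs.1 (by linarith [mem_Ioi.1 h]), hs.2⟩
          rw [indicator_of_mem h, indicator_of_mem h3,
            show s + (y - (x - s)) = 2 * s + (y - x) by ring,
            show s - (y - (x - s)) = x - y by ring]
          ring
        · have h3 : s ∉ Ioc (max 0 (x - y)) x := fun h3 =>
            h (by
              have := (le_max_right 0 (x - y)).trans_lt h3.1
              exact mem_Ioi.2 (by linarith))
          rw [indicator_of_notMem h, indicator_of_notMem h3]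
      · have h3 : s ∉ Ioc (max 0 (x - y)) x := fun h3 =>
          hs ⟨(le_max_left 0 (x - y)).trans_lt h3.1, h3.2⟩
        rw [indicator_of_notMem hs, indicator_of_notMem h3]
    rw [e1, integral_const_mul, ← intervalIntegral.integral_of_le
      (max_le hx.le (by linarith)), integral_two_mul_heatKer ht]
    congr 2
    · rcases le_total 0 (x - y) with h | h
      · rw [max_eq_right h, ← heatKer_neg]
        congr 1
        ring
      · rw [max_eq_left h]
        congr 1
        ring
    · congr 1
      ring
  have h3 : c = Real.exp (-(μ * x + μ ^ 2 * t / 2)) * Real.exp (μ * y) := by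
    rw [hc, ← Real.exp_add]
    congr 1
    ring
  rw [h1, h2, ← mul_assoc, ← h3]
  unfold robinKer
  rw [add_comm y x]
  ring

lemma integral_payoffSlope {F' : ℝ → ℝ} (hF' : Continuous F') {C : ℝ}
    (hC' : ∀ y ≥ 0, |F' y| ≤ C) (μ lam : ℝ) {t x : ℝ} (ht : 0 < t) (hx : 0 < x) :
    ∫ p, payoffSlope F' lam x p.1 p.2 * jointDensity μ t p.1 p.2 ∂quarterMeasure =
      Real.exp (-(μ * x + μ ^ 2 * t / 2)) *
        ∫ y in Ioi 0, Real.exp (μ * y) * F' y * robinKer (lam + μ) x t y := by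
  have hC0 : 0 ≤ C := (abs_nonneg _).trans (hC' 0 le_rfl)
  obtain ⟨K, -, hK⟩ := exists_jointDensity_bound μ ht (abs_nonneg lam)
  obtain ⟨K', hK'0, hK'⟩ := exists_shiftedDensity_bound μ lam ht hx.le
  have i1 : Integrable
      (fun p : ℝ × ℝ => payoffSlope F' lam x p.1 p.2 * jointDensity μ t p.1 p.2)
      quarterMeasure :=
    integrable_quarterMeasure (K := C * Real.exp (|lam| * |x|) * K)
      ((continuous_payoffSlope hF' lam x).mul (continuous_jointDensity μ ht)).aestronglyMeasurable
      fun s hs y hy => abs_mul_jointDensity_le ht hK (by positivity) hs.le hy.le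
        (abs_payoffSlope_le hC' lam x hs.le hy.le)
  have i2 : Integrable (fun p : ℝ × ℝ => F' p.2 * shiftedDensity μ lam t x p.1 p.2)
      quarterMeasure := by
    refine integrable_quarterMeasure (K := C * K') ?_ fun s hs y hy => ?_
    · exact ((hF'.comp continuous_snd).measurable.mul
        (measurable_shiftedDensity μ lam x ht)).aestronglyMeasurable
    · rw [abs_mul, mul_assoc]
      exact mul_le_mul (hC' y hy.le) (hK' s hs y hy) (abs_nonneg _) hC0
  unfold quarterMeasure at i1 i2 ⊢
  rw [integral_prod _ i1]
  simp only [integral_payoffSlope_slice]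
  rw [integral_integral_swap i2, ← integral_const_mul]
  refine setIntegral_congr_fun measurableSet_Ioi fun y hy => ?_
  rw [integral_const_mul, integral_shiftedDensity μ lam ht hx hy]
  ring

lemma IsInitialData.exists_extension {f : ℝ → ℝ} (hf : IsInitialData f) :
    ∃ (F F' : ℝ → ℝ) (C : ℝ), (∀ y, HasDerivAt F (F' y) y) ∧ Continuous F' ∧
      (∀ y ≥ 0, F y = f y) ∧ (∀ y ≥ 0, F' y = derivWithin f (Ici 0) y) ∧
      (∀ y ≥ 0, |F y| ≤ C) ∧ (∀ y ≥ 0, |F' y| ≤ C) ∧ Tendsto F atTop (nhds 0) := by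
  obtain ⟨hsm, ⟨C, hC⟩, hlim⟩ := hf
  set F' : ℝ → ℝ := fun y => derivWithin f (Ici 0) (max y 0) with hF'
  have hc : Continuous F' := by
    refine (hsm.continuousOn_derivWithin (uniqueDiffOn_Ici 0) le_rfl).comp_continuous
      (by fun_prop) fun y => le_max_right y 0
  have e' : ∀ y ≥ 0, F' y = derivWithin f (Ici 0) y := fun y hy => by
    simp only [hF', max_eq_left hy]
  have e : ∀ y ≥ 0, f 0 + ∫ r in (0 : ℝ)..y, F' r = f y := by
    intro y hy
    rw [intervalIntegral.integral_eq_sub_of_hasDerivAt_of_le hy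
      (hsm.continuousOn.mono Icc_subset_Ici_self) ?_ (hc.intervalIntegrable _ _)]
    · ring
    · intro r hr
      rw [e' r hr.1.le]
      exact ((hsm.differentiableOn one_ne_zero r hr.1.le).hasDerivWithinAt).hasDerivAt
        (Ici_mem_nhds hr.1)
  refine ⟨fun y => f 0 + ∫ r in (0 : ℝ)..y, F' r, F', C, ?_, hc, e, e', ?_, ?_, ?_⟩
  · exact fun y => (hc.integral_hasStrictDerivAt 0 y).hasDerivAt.const_add _
  · intro y hy
    simp only [e y hy]
    exact (hC y hy).1
  · exact fun y _ => (hC _ (le_max_right y 0)).2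
  · refine hlim.congr' ?_
    filter_upwards [eventually_ge_atTop 0] with y hy using (e y hy).symm

lemma integral_Iic_eq_integral_Ioi_sub (h : ℝ → ℝ) (s : ℝ) :
    ∫ b in Iic s, h b = ∫ y in Ioi 0, h (s - y) := by
  rw [integral_Iic_eq_integral_Iio, ← integral_indicator measurableSet_Iio,
    ← integral_indicator measurableSet_Ioi, ← integral_sub_left_eq_self _ volume s]
  congr 1
  ext y
  by_cases hy : y ∈ Ioi (0 : ℝ)
  · rw [indicator_of_mem hy, indicator_of_mem (by simpa using hy)]
  · rw [indicator_of_notMem hy, indicator_of_notMem (by simpa using hy)]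

lemma integral_integral_gker_eq {f F F' : ℝ → ℝ} (hF : ∀ y, HasDerivAt F (F' y) y)
    (hF' : Continuous F') (e : ∀ y ≥ 0, F y = f y)
    (e' : ∀ y ≥ 0, F' y = derivWithin f (Ici 0) y) {C : ℝ} (hC : ∀ y ≥ 0, |F y| ≤ C)
    (hC' : ∀ y ≥ 0, |F' y| ≤ C) (μ ν : ℝ) {t x : ℝ} (ht : 0 < t) (hx : 0 ≤ x) :
    ∫ s in Ioi (0 : ℝ), ∫ b in Iic s,
        (f (max x s - b) - derivWithin f (Ici 0) (max x s - b) *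
            ∫ r in (0 : ℝ)..(max x s - x), Real.exp (-2 * (ν - μ) * r)) * gker μ t b s =
      ∫ p, payoff F F' (2 * (ν - μ)) x p.1 p.2 * jointDensity μ t p.1 p.2 ∂quarterMeasure := by
  have hi := integrable_payoff_mul_jointDensity hF hF' hC hC' μ (2 * (ν - μ)) ht hx
  unfold quarterMeasure at hi ⊢
  rw [integral_prod _ hi]
  refine setIntegral_congr_fun measurableSet_Ioi fun s hs => ?_
  simp only [integral_Iic_eq_integral_Ioi_sub _ s]
  refine setIntegral_congr_fun measurableSet_Ioi fun y hy => ?_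
  have h0 : 0 ≤ y + max (x - s) 0 := add_nonneg (le_of_lt hy) (le_max_right _ _)
  simp only [gker_eq_jointDensity μ ht (le_of_lt hs) (le_of_lt hy), payoff, e _ h0,
    e' y (le_of_lt hy)]
  congr 1
  have hl : max x s - x = max (s - x) 0 := by
    rw [max_comm x s, ← max_sub_sub_right s x x, sub_self]
  have hX : max x s - (s - y) = y + max (x - s) 0 := by
    rw [← sub_self s, max_sub_sub_right]
    ring
  rw [hX, hl, show (fun r => Real.exp (-2 * (ν - μ) * r)) =
    fun r => Real.exp (-(2 * (ν - μ)) * r) by ext r; congr 1; ring]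
  congr 1
  rcases le_total x s with h | h
  · rw [max_eq_right (sub_nonpos.2 h), add_zero]
  · rw [max_eq_right (sub_nonpos.2 h), intervalIntegral.integral_same, mul_zero, mul_zero]

/-- A function that is continuous on `[0, ∞)`, has zero derivative inside and vanishes at infinity
is zero on `[0, ∞)`. -/
lemma eq_zero_of_hasDerivAt_zero_of_tendsto {D : ℝ → ℝ} (hc : ContinuousOn D (Ici 0))
    (hd : ∀ x > 0, HasDerivAt D 0 x) (hlim : Tendsto D atTop (nhds 0)) {x : ℝ} (hx : 0 ≤ x) :
    D x = 0 := by
  have hconst : ∀ y ≥ 0, D y = D 0 := by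
    intro y hy
    rcases eq_or_lt_of_le hy with rfl | hy
    · rfl
    obtain ⟨c, -, h⟩ := exists_hasDerivAt_eq_slope D 0 hy (hc.mono Icc_subset_Ici_self)
      fun z hz => hd z hz.1
    rw [Pi.zero_apply, eq_comm, div_eq_zero_iff] at h
    exact sub_eq_zero.1 (h.resolve_right (by linarith))
  have h1 : Tendsto D atTop (nhds (D x)) := by
    refine tendsto_const_nhds.congr' ?_
    filter_upwards [eventually_ge_atTop 0] with y hy
    rw [hconst x hx, hconst y hy]
  exact tendsto_nhds_unique h1 hlim

/-- probabilistic (double-integral) representation of the solution. -/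
theorem stroock_williams_probabilistic_representation (μ ν : ℝ) (f : ℝ → ℝ)
    (hf : IsInitialData f) (u : ℝ → ℝ → ℝ) (hu : IsSWSolution μ ν f u) :
    ∀ t > (0 : ℝ), ∀ x ≥ (0 : ℝ),
      u t x = ∫ s in Set.Ioi (0 : ℝ), ∫ b in Set.Iic s,
        (f (max x s - b) -
          derivWithin f (Set.Ici 0) (max x s - b) *
            ∫ r in (0 : ℝ)..(max x s - x), Real.exp (-2 * (ν - μ) * r)) *
          gker μ t b s := by
  intro t ht x hx
  obtain ⟨F, F', C, hF, hF', e, e', hC, hC', hlim⟩ := hf.exists_extension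
  rw [integral_integral_gker_eq hF hF' e e' hC hC' μ ν ht hx]
  set R : ℝ → ℝ := fun x =>
    ∫ p, payoff F F' (2 * (ν - μ)) x p.1 p.2 * jointDensity μ t p.1 p.2 ∂quarterMeasure
  have hR : ∀ x ≥ 0, HasDerivAt R _ x := fun x hx =>
    hasDerivAt_integral_payoff hF hF' hC hC' μ (2 * (ν - μ)) ht hx
  obtain ⟨-, -, hux, -⟩ := hu.exists_regularity
  suffices h : u t x - R x = 0 from sub_eq_zero.1 h
  refine eq_zero_of_hasDerivAt_zero_of_tendsto (D := fun x => u t x - R x) ?_ ?_ ?_ hx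
  · exact fun y hy => (hux t ht y hy).continuousWithinAt.sub
      (hR y hy).continuousAt.continuousWithinAt
  · intro y hy
    refine (((hux t ht y hy.le).hasDerivAt (Ici_mem_nhds hy)).sub (hR y hy.le)).congr_deriv ?_
    rw [integral_payoffSlope hF' hC' μ (2 * (ν - μ)) ht hy, hu.ux_eq_integral ht hy,
      show 2 * (ν - μ) + μ = 2 * ν - μ by ring, sub_eq_zero]
    congr 1
    refine setIntegral_congr_fun measurableSet_Ioi fun z hz => ?_
    simp only [e' z (le_of_lt hz)]
  · simpa using (hu.2.2.1 t ht).sub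
      (tendsto_integral_payoff hF hF' hC hC' hlim μ (2 * (ν - μ)) ht)
end

section
/- Let μ, ν ∈ ℝ and let u be infinitely differentiable on (0,∞) × [0,∞) (one-sided derivatives in x at x = 0) satisfying u_t(t,x) = μ u_x(t,x) + (1/2) u_xx(t,x) for all t > 0 and x ≥ 0, and u_t(t,0) = ν u_x(t,0) for all t > 0. Then v := u_x satisfies v_t(t,x) = μ v_x(t,x) + (1/2) v_xx(t,x) for all t > 0 and x ≥ 0, and the elastic boundary condition v_x(t,0) = 2(ν−μ) v(t,0) for all t > 0. -/
open MeasureTheory Set Filter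

/-- The time-space domain `(0,∞) × [0,∞)`. -/
abbrev spaceTime : Set (ℝ × ℝ) := Set.Ioi 0 ×ˢ Set.Ici 0

theorem uniqueDiffOn_spaceTime : UniqueDiffOn ℝ spaceTime :=
  isOpen_Ioi.uniqueDiffOn.prod (uniqueDiffOn_Ici 0)

theorem spaceTime_subset_closure_interior : spaceTime ⊆ closure (interior spaceTime) := by
  rw [interior_prod_eq, closure_prod_eq, interior_Ioi, interior_Ici, closure_Ioi]
  exact Set.prod_mono Set.Ioi_subset_Ici_self subset_rfl

theorem ux_eq_fderivWithin {u : ℝ → ℝ → ℝ} {t x : ℝ}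
    (hu : DifferentiableWithinAt ℝ (fun p : ℝ × ℝ => u p.1 p.2) spaceTime (t, x))
    (ht : 0 < t) (hx : 0 ≤ x) :
    ux u t x = fderivWithin ℝ (fun p : ℝ × ℝ => u p.1 p.2) spaceTime (t, x) (0, 1) :=
  (hu.hasFDerivWithinAt.comp_hasDerivWithinAt x
    ((hasDerivWithinAt_const x (Set.Ici 0) t).prodMk (hasDerivWithinAt_id x (Set.Ici 0)))
    fun _ hz => ⟨ht, hz⟩).derivWithin (uniqueDiffOn_Ici 0 x hx)

theorem ut_eq_fderivWithin {u : ℝ → ℝ → ℝ} {t x : ℝ}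
    (hu : DifferentiableWithinAt ℝ (fun p : ℝ × ℝ => u p.1 p.2) spaceTime (t, x))
    (ht : 0 < t) (hx : 0 ≤ x) :
    ut u t x = fderivWithin ℝ (fun p : ℝ × ℝ => u p.1 p.2) spaceTime (t, x) (1, 0) := by
  have hmem : ∀ᶠ s in nhds t, (s, x) ∈ spaceTime := by
    filter_upwards [lt_mem_nhds ht] with s hs using ⟨hs, hx⟩
  exact (hu.hasFDerivWithinAt.comp_hasDerivAt t
    ((hasDerivAt_id t).prodMk (hasDerivAt_const t x)) hmem).deriv

theorem contDiffOn_ux {u : ℝ → ℝ → ℝ} {m n : WithTop ℕ∞}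
    (hu : ContDiffOn ℝ n (fun p : ℝ × ℝ => u p.1 p.2) spaceTime) (hmn : m + 1 ≤ n) :
    ContDiffOn ℝ m (fun p : ℝ × ℝ => ux u p.1 p.2) spaceTime :=
  ((hu.fderivWithin uniqueDiffOn_spaceTime hmn).clm_apply contDiffOn_const).congr fun p hp =>
    ux_eq_fderivWithin (hu.differentiableOn (by rintro rfl; simp at hmn) p hp) hp.1 hp.2

/-- Time and one-sided space derivatives of a `C²` function commute. -/
theorem ut_ux_eq_ux_ut {u : ℝ → ℝ → ℝ} {t x : ℝ}
    (hu : ContDiffOn ℝ 2 (fun p : ℝ × ℝ => u p.1 p.2) spaceTime) (ht : 0 < t) (hx : 0 ≤ x) :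
    ut (ux u) t x = ux (ut u) t x := by
  have hmem : (t, x) ∈ spaceTime := ⟨ht, hx⟩
  have hD : DifferentiableOn ℝ (fderivWithin ℝ (fun p : ℝ × ℝ => u p.1 p.2) spaceTime)
      spaceTime :=
    (hu.fderivWithin uniqueDiffOn_spaceTime (m := 1) (by norm_num)).differentiableOn one_ne_zero
  have hud := hu.differentiableOn two_ne_zero
  have hux : Set.EqOn (fun p : ℝ × ℝ => ux u p.1 p.2)
      (fun p => fderivWithin ℝ (fun p : ℝ × ℝ => u p.1 p.2) spaceTime p (0, 1)) spaceTime :=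
    fun p hp => ux_eq_fderivWithin (hud p hp) hp.1 hp.2
  have hut : Set.EqOn (fun p : ℝ × ℝ => ut u p.1 p.2)
      (fun p => fderivWithin ℝ (fun p : ℝ × ℝ => u p.1 p.2) spaceTime p (1, 0)) spaceTime :=
    fun p hp => ut_eq_fderivWithin (hud p hp) hp.1 hp.2
  have happ (w : ℝ × ℝ) := (hD (t, x) hmem).clm_apply
    (differentiableWithinAt_const (𝕜 := ℝ) (s := spaceTime) (x := (t, x)) w)
  rw [ut_eq_fderivWithin ((happ _).congr hux (hux hmem)) ht hx,
    ux_eq_fderivWithin ((happ _).congr hut (hut hmem)) ht hx,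
    fderivWithin_congr hux (hux hmem), fderivWithin_congr hut (hut hmem),
    fderivWithin_clm_apply (uniqueDiffOn_spaceTime _ hmem) (hD _ hmem)
      (differentiableWithinAt_const _),
    fderivWithin_clm_apply (uniqueDiffOn_spaceTime _ hmem) (hD _ hmem)
      (differentiableWithinAt_const _)]
  simpa using (hu _ hmem).isSymmSndFDerivWithinAt (by simp) uniqueDiffOn_spaceTime
    (spaceTime_subset_closure_interior hmem) hmem (1, 0) (0, 1)

theorem differentiableWithinAt_space {u : ℝ → ℝ → ℝ} {t x : ℝ}
    (hu : DifferentiableOn ℝ (fun p : ℝ × ℝ => u p.1 p.2) spaceTime) (ht : 0 < t) (hx : 0 ≤ x) :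
    DifferentiableWithinAt ℝ (fun z => u t z) (Set.Ici 0) x :=
  (hu (t, x) ⟨ht, hx⟩).comp x
    ((differentiableWithinAt_const t).prodMk differentiableWithinAt_id) fun _ hz => ⟨ht, hz⟩

/-- `v = u_x` satisfies the same equation with an elastic
boundary condition. -/
theorem spatial_derivative_elastic_boundary (μ ν : ℝ) (u : ℝ → ℝ → ℝ)
    (hsmooth : ContDiffOn ℝ (⊤ : ℕ∞) (fun p : ℝ × ℝ => u p.1 p.2) (Set.Ioi 0 ×ˢ Set.Ici 0))
    (hpde : ∀ t > (0 : ℝ), ∀ x ≥ (0 : ℝ),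
      ut u t x = μ * ux u t x + (1 / 2) * uxx u t x)
    (hbdry : ∀ t > (0 : ℝ), ut u t 0 = ν * ux u t 0) :
    (∀ t > (0 : ℝ), ∀ x ≥ (0 : ℝ),
      ut (fun t x => ux u t x) t x =
        μ * ux (fun t x => ux u t x) t x + (1 / 2) * uxx (fun t x => ux u t x) t x) ∧
    (∀ t > (0 : ℝ),
      ux (fun t x => ux u t x) t 0 = 2 * (ν - μ) * ux u t 0) := by
  have hv : ContDiffOn ℝ 2 (fun p : ℝ × ℝ => ux u p.1 p.2) spaceTime :=
    contDiffOn_ux (contDiffOn_infty.1 hsmooth 3) (by norm_num)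
  have hvx : ContDiffOn ℝ 1 (fun p : ℝ × ℝ => uxx u p.1 p.2) spaceTime :=
    contDiffOn_ux (u := ux u) hv (by norm_num)
  refine ⟨fun t ht x hx => ?_, fun t ht => ?_⟩
  · have h1 := differentiableWithinAt_space (hv.differentiableOn two_ne_zero) ht hx
    have h2 := differentiableWithinAt_space (hvx.differentiableOn one_ne_zero) ht hx
    calc ut (ux u) t x = ux (ut u) t x :=
          ut_ux_eq_ux_ut (contDiffOn_infty.1 hsmooth 2) ht hx
      _ = derivWithin (fun z => μ * ux u t z + (1 / 2) * uxx u t z) (Set.Ici 0) x :=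
          derivWithin_congr (fun z hz => hpde t ht z hz) (hpde t ht x hx)
      _ = μ * ux (ux u) t x + (1 / 2) * uxx (ux u) t x :=
          ((h1.hasDerivWithinAt.const_mul μ).add
            (h2.hasDerivWithinAt.const_mul (1 / 2))).derivWithin (uniqueDiffOn_Ici 0 x hx)
  · change uxx u t 0 = _
    linarith [hpde t ht 0 le_rfl, hbdry t ht]
end
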